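/- arXiv:1508.05378 — 3 statements merged into one kernel-verified Lean document; each statement's English description precedes it below -/
import Mathlib

section
/- There is an infinite set 𝓗 of pairwise vertex-disjoint infinite 2-edge-connected graphs such that the vertex set of each member H of 𝓗 has cardinality at most the cardinality of 𝓗, and 𝓗 is an antichain with respect to the immersion relation: no member of 𝓗 is immersed in a different member of 𝓗. -/
open SimpleGraph

/-- An immersion (strong immersion) of `H` into `G`. -/
structure Immersion {V W : Type*} (H : SimpleGraph V) (G : SimpleGraph W) where
  toFun : V → W
  injective : Function.Injective toFun
  walk : ∀ ⦃u v : V⦄, H.Adj u v → G.Walk (toFun u) (toFun v)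
  walk_isPath : ∀ ⦃u v : V⦄ (h : H.Adj u v), (walk h).IsPath
  walk_nontrivial : ∀ ⦃u v : V⦄ (h : H.Adj u v), 0 < (walk h).length
  walk_symm : ∀ ⦃u v : V⦄ (h : H.Adj u v), walk h.symm = (walk h).reverse
  walk_edgeDisjoint : ∀ ⦃u v u' v' : V⦄ (h : H.Adj u v) (h' : H.Adj u' v'),
    s(u, v) ≠ s(u', v') → ∀ e ∈ (walk h).edges, e ∉ (walk h').edges
  avoid : ∀ ⦃u v : V⦄ (h : H.Adj u v) (w : V), w ≠ u → w ≠ v → toFun w ∉ (walk h).support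

/-- `H` is immersed in `G`. -/
def Immersed {V W : Type*} (H : SimpleGraph V) (G : SimpleGraph W) : Prop :=
  Nonempty (Immersion H G)

/-- A graph is 2-edge-connected if it is connected, has an edge, and stays connected
after deletion of any single edge. -/
def TwoEdgeConnected {V : Type*} (G : SimpleGraph V) : Prop :=
  G.Connected ∧ G.edgeSet.Nonempty ∧ ∀ e ∈ G.edgeSet, (G.deleteEdges {e}).Connected

/-- A blob of `G` is a maximal 2-edge-connected subgraph of `G`. -/
def IsBlob {V : Type*} (G : SimpleGraph V) (B : G.Subgraph) : Prop :=
  TwoEdgeConnected B.coe ∧ ∀ B' : G.Subgraph, B ≤ B' → TwoEdgeConnected B'.coe → B' = B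

/-- An immersion induces an isomorphism if its vertex map is a bijection preserving
and reflecting adjacency. -/
def Immersion.InducesIso {V W : Type*} {H : SimpleGraph V} {G : SimpleGraph W}
    (φ : Immersion H G) : Prop :=
  Function.Bijective φ.toFun ∧ ∀ u v : V, H.Adj u v ↔ G.Adj (φ.toFun u) (φ.toFun v)

/-- An immersion is proper if it does not induce an isomorphism. -/
def Immersion.IsProper {V W : Type*} {H : SimpleGraph V} {G : SimpleGraph W}
    (φ : Immersion H G) : Prop := ¬ φ.InducesIso

/-- `H` is properly immersed in `G`. -/
def ProperlyImmersed {V W : Type*} (H : SimpleGraph V) (G : SimpleGraph W) : Prop :=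
  ∃ φ : Immersion H G, φ.IsProper

/-- A self-immersion is trivial if it induces the identity map on vertices and sends
each edge to itself. -/
def Immersion.IsTrivial {V : Type*} {G : SimpleGraph V} (φ : Immersion G G) : Prop :=
  (∀ v, φ.toFun v = v) ∧ ∀ ⦃u v : V⦄ (h : G.Adj u v), (φ.walk h).edges = [s(u, v)]

namespace Blob

/-- Iterated power sets of `ℕ`. -/
def J : ℕ → Type
  | 0 => ℕ
  | n + 1 => Set (J n)

/-- Alphabets. -/
def Al : ℕ → Type
  | 0 => Bool
  | k + 1 => J k ⊕ Al k

/-- Two sequences agree below `n`. -/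
def Agree {α : Type} (n : ℕ) (z y : ℕ → α) : Prop := ∀ i < n, z i = y i

lemma exists_avoid {R : Type} [Infinite R] (F : R → R)
    (hF : Cardinal.mk (Set.range F) = Cardinal.mk R) (Bad : Set R)
    (hBad : Cardinal.mk Bad < Cardinal.mk R) : ∃ x, x ∉ Bad ∧ F x ∉ Bad := by
  by_contra hcon
  push Not at hcon
  have hs : ∀ y : Set.range F, ∃ x, F x = y.1 := fun y => y.2
  choose s hs using hs
  have hinj : Function.Injective s := by
    intro y y' h
    apply Subtype.ext
    rw [← hs y, ← hs y', h]
  classical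
  let G : Set.range F → Bad ⊕ Bad := fun y =>
    if h : s y ∈ Bad then Sum.inl ⟨s y, h⟩ else Sum.inr ⟨y.1, by
      have := hcon _ h
      rwa [hs y] at this⟩
  have hG : Function.Injective G := by
    intro y y' h
    by_cases h1 : s y ∈ Bad <;> by_cases h2 : s y' ∈ Bad
    · simp only [G, h1, h2, dif_pos, Sum.inl.injEq, Subtype.mk.injEq] at h
      exact hinj h
    · simp [G, h1, h2] at h
    · simp [G, h1, h2] at h
    · simp only [G, h1, h2, dif_neg, not_false_eq_true, Sum.inr.injEq, Subtype.mk.injEq] at h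
      exact Subtype.ext h
  have h1 := Cardinal.mk_le_of_injective hG
  rw [hF] at h1
  simp only [Cardinal.mk_sum, Cardinal.lift_id] at h1
  exact absurd h1 (not_le.mpr (Cardinal.add_lt_of_lt (Cardinal.aleph0_le_mk R) hBad hBad))

lemma exists_selection {Θ R : Type} [Infinite R] (hΘ : Cardinal.mk Θ ≤ Cardinal.mk R)
    (F : Θ → R → R) (hF : ∀ θ, Cardinal.mk (Set.range (F θ)) = Cardinal.mk R) :
    ∃ x : Θ → R, ∀ θ θ', θ ≠ θ' → x θ ≠ x θ' ∧ F θ (x θ) ≠ x θ' := by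
  classical
  obtain ⟨r, wo, hr⟩ := Cardinal.exists_ord_eq Θ
  let bad : (θ : Θ) → ((θ' : Θ) → r θ' θ → R) → Set R := fun θ ih =>
    Set.range (fun p : {θ' // r θ' θ} => ih p.1 p.2) ∪
      Set.range (fun p : {θ' // r θ' θ} => F p.1 (ih p.1 p.2))
  have hsmall : ∀ θ, Cardinal.mk {θ' // r θ' θ} < Cardinal.mk R := by
    intro θ
    refine lt_of_lt_of_le ?_ hΘ
    exact Cardinal.card_typein_lt θ hr
  have hbad : ∀ θ ih, Cardinal.mk (bad θ ih) < Cardinal.mk R := by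
    intro θ ih
    refine lt_of_le_of_lt (Cardinal.mk_union_le _ _) ?_
    exact Cardinal.add_lt_of_lt (Cardinal.aleph0_le_mk R)
      (lt_of_le_of_lt Cardinal.mk_range_le (hsmall θ))
      (lt_of_le_of_lt Cardinal.mk_range_le (hsmall θ))
  have hex : ∀ θ ih, ∃ x, x ∉ bad θ ih ∧ F θ x ∉ bad θ ih := fun θ ih =>
    exists_avoid (F θ) (hF θ) _ (hbad θ ih)
  let x : Θ → R := wo.wf.fix (fun θ ih => Classical.choose (hex θ ih))
  have hx : ∀ θ, x θ ∉ bad θ (fun θ' _ => x θ') ∧ F θ (x θ) ∉ bad θ (fun θ' _ => x θ') := by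
    intro θ
    have : x θ = Classical.choose (hex θ (fun θ' _ => x θ')) := wo.wf.fix_eq _ _
    have h2 := Classical.choose_spec (hex θ (fun θ' _ => x θ'))
    rw [← this] at h2
    exact h2
  have key : ∀ θ θ', r θ' θ → x θ ≠ x θ' ∧ F θ (x θ) ≠ x θ' ∧ F θ' (x θ') ≠ x θ := by
    intro θ θ' h
    refine ⟨fun e => (hx θ).1 (Or.inl ⟨⟨θ', h⟩, e.symm⟩),
      fun e => (hx θ).2 (Or.inl ⟨⟨θ', h⟩, e.symm⟩),
      fun e => (hx θ).1 (Or.inr ⟨⟨θ', h⟩, e⟩)⟩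
  refine ⟨x, fun θ θ' hne => ?_⟩
  rcases trichotomous_of r θ θ' with h | h | h
  · have := key θ' θ h
    exact ⟨this.1.symm, this.2.2⟩
  · exact absurd h hne
  · have := key θ θ' h
    exact ⟨this.1, this.2.1⟩

lemma exists_diag {R F Λ : Type} [Infinite R] [Countable Λ] (hFR : Cardinal.mk F = Cardinal.mk R)
    (hR : Cardinal.aleph0 < Cardinal.mk R) (Φ : F → R → R) :
    ∃ B : Λ → Set R, (∀ l, (B l).Nonempty) ∧ ∀ l φ,
      (∀ y, {x | x ∈ B l ∧ Φ φ x = y}.Countable) → ∃ x ∈ B l, ∀ l', l' ≠ l → Φ φ x ∉ B l' := by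
  classical
  let G : F × Λ → R → R := fun θ =>
    if Cardinal.mk (Set.range (Φ θ.1)) = Cardinal.mk R then Φ θ.1 else id
  have hG : ∀ θ, Cardinal.mk (Set.range (G θ)) = Cardinal.mk R := by
    intro θ
    by_cases h : Cardinal.mk (Set.range (Φ θ.1)) = Cardinal.mk R
    · simp only [G, h, if_true]
    · simp [G, h]
  have hΘ : Cardinal.mk (F × Λ) ≤ Cardinal.mk R := by
    rw [Cardinal.mk_prod, Cardinal.lift_id, Cardinal.lift_id, hFR]
    calc Cardinal.mk R * Cardinal.mk Λ ≤ Cardinal.mk R * Cardinal.mk R :=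
          mul_le_mul_right (Cardinal.mk_le_aleph0.trans hR.le) _
      _ = Cardinal.mk R := Cardinal.mul_eq_self hR.le
  obtain ⟨x, hx⟩ := exists_selection hΘ G hG
  have hFne : Nonempty F := by
    rw [← Cardinal.mk_ne_zero_iff, hFR]
    exact (lt_trans Cardinal.aleph0_pos hR).ne'
  refine ⟨fun l => Set.range (fun φ => x (φ, l)), fun l => Set.range_nonempty _, ?_⟩
  intro l φ hc
  by_cases h : Cardinal.mk (Set.range (Φ φ)) = Cardinal.mk R
  · refine ⟨x (φ, l), ⟨φ, rfl⟩, ?_⟩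
    rintro l' hl' ⟨φ', he⟩
    have := (hx (φ, l) (φ', l') (by intro e; exact hl' (Prod.ext_iff.mp e).2.symm)).2
    apply this
    simp only [G, h, if_true]
    exact he.symm
  · exfalso
    have hlt : Cardinal.mk (Set.range (Φ φ)) < Cardinal.mk R :=
      lt_of_le_of_ne (Cardinal.mk_set_le _) h
    let q : F → Set.range (Φ φ) := fun ψ => ⟨Φ φ (x (ψ, l)), ⟨_, rfl⟩⟩
    have hxinj : Function.Injective (fun ψ : F => x (ψ, l)) := by
      intro a b hab
      by_contra hne
      exact (hx (a, l) (b, l) (by intro e; exact hne (Prod.ext_iff.mp e).1)).1 hab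
    have hq : ∀ y, Cardinal.mk (q ⁻¹' {y}) ≤ Cardinal.aleph0 := by
      intro y
      have hcy := hc y.1
      have : Set.Countable (q ⁻¹' {y}) := by
        refine (hcy.preimage hxinj).mono ?_
        intro ψ hψ
        refine ⟨⟨ψ, rfl⟩, ?_⟩
        exact congrArg Subtype.val hψ
      exact Cardinal.le_aleph0_iff_set_countable.mpr this
    have h3 := Cardinal.mk_le_mk_mul_of_mk_preimage_le q hq
    rw [hFR] at h3
    exact absurd h3 (not_le.mpr (Cardinal.mul_lt_of_lt hR.le hlt hR))

/-- The first `n` entries. -/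
def pre {α : Type} (n : ℕ) (z : ℕ → α) : List α := (List.range n).map z

lemma pre_eq_iff {α : Type} (n : ℕ) (z y : ℕ → α) : pre n z = pre n y ↔ Agree n z y := by
  simp [pre, Agree]

@[simp] lemma pre_length {α : Type} (n : ℕ) (z : ℕ → α) : (pre n z).length = n := by
  simp [pre]

lemma pre_take {α : Type} {m n : ℕ} (h : n ≤ m) (z : ℕ → α) : (pre m z).take n = pre n z := by
  simp [pre, ← List.map_take, List.take_range, Nat.min_eq_left h]

/-- The diagonal property of a labelled family of subsets of Cantor space. -/
def Diag (B : ℕ × List Bool → Set (ℕ → Bool)) : Prop :=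
  (∀ l, (B l).Nonempty) ∧ ∀ l N (g : (ℕ → Bool) → (ℕ → Bool)),
    (∀ x ∈ B l, ∀ x' ∈ B l, ∀ n, Agree (n + N) x x' → g x n = g x' n) →
    (∀ y, {x | x ∈ B l ∧ g x = y}.Countable) → ∃ x ∈ B l, ∀ l', l' ≠ l → g x ∉ B l'

lemma exists_Diag : ∃ B, Diag B := by
  classical
  have hR : Cardinal.mk (ℕ → Bool) = Cardinal.continuum := by simp
  have hF : Cardinal.mk ((List Bool → Bool) × ℕ) = Cardinal.mk (ℕ → Bool) := by
    rw [hR]; simp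
  obtain ⟨B, hB, h⟩ := exists_diag (Λ := ℕ × List Bool) hF
    (by rw [hR]; exact Cardinal.aleph0_lt_continuum)
    (fun hN x n => hN.1 (pre (n + hN.2) x))
  refine ⟨B, hB, fun l N g hg hc => ?_⟩
  let hh : List Bool → Bool := fun s =>
    if hs : ∃ x ∈ B l, pre s.length x = s then g hs.choose (s.length - N) else false
  have heq : ∀ x ∈ B l, (fun n => hh (pre (n + N) x)) = g x := by
    intro x hx
    funext n
    have hs : ∃ x' ∈ B l, pre (pre (n + N) x).length x' = pre (n + N) x := ⟨x, hx, by simp⟩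
    simp only [hh, dif_pos hs]
    have h2 := hs.choose_spec.2
    have h1 := hs.choose_spec.1
    set x' := hs.choose
    rw [pre_length, pre_eq_iff] at h2
    rw [pre_length, Nat.add_sub_cancel]
    exact hg _ h1 _ hx n h2
  obtain ⟨x, hx, hx'⟩ := h l (hh, N) (by
    intro y
    refine (hc y).mono ?_
    rintro x ⟨hx, hxy⟩
    exact ⟨hx, by rw [← heq x hx]; exact hxy⟩)
  refine ⟨x, hx, fun l' hl' => ?_⟩
  rw [← heq x hx]
  exact hx' l' hl'

def scons {α : Type} (a : α) (z : ℕ → α) : ℕ → α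
  | 0 => a
  | n + 1 => z n

/-- The labelled sets of sequences. -/
def SS (B : ℕ × List Bool → Set (ℕ → Bool)) : (k : ℕ) → J k → List Bool → Set (ℕ → Al k)
  | 0, i, bs => B (i, bs)
  | k + 1, σ, bs => {z | ∃ (j : J k) (b : Bool), (b = true ↔ σ j) ∧
      ∃ y ∈ SS B k j (b :: bs), z = scons (Sum.inl j) (fun n => Sum.inr (y n))}

/-- Decode a letter to a bit. -/
def dec : (k : ℕ) → Al k → Bool
  | 0 => fun b => b
  | k + 1 => fun a => Sum.elim (fun _ => false) (dec k) a

lemma SSdec (B) : ∀ (k : ℕ) (σ : J k) (bs : List Bool) (z), z ∈ SS B k σ bs →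
    ∃ i bs', bs'.length = k + bs.length ∧ (fun n => dec k (z (n + k))) ∈ B (i, bs') := by
  intro k
  induction k with
  | zero => intro σ bs z hz; exact ⟨σ, bs, by simp, hz⟩
  | succ k ih =>
    rintro σ bs z ⟨j, b, hb, y, hy, rfl⟩
    obtain ⟨i, bs', h1, h2⟩ := ih j _ y hy
    exact ⟨i, bs', by rw [h1]; simp; omega, h2⟩

lemma SSinj (B) : ∀ (k : ℕ) (σ : J k) (bs : List Bool) (z z'), z ∈ SS B k σ bs → z' ∈ SS B k σ bs →
    Agree k z z' → (∀ n, dec k (z (n + k)) = dec k (z' (n + k))) → z = z' := by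
  intro k
  induction k with
  | zero => intro σ bs z z' _ _ _ h; funext n; exact h n
  | succ k ih =>
    rintro σ bs z z' ⟨j, b, hb, y, hy, rfl⟩ ⟨j', b', hb', y', hy', rfl⟩ ha hd
    have h0 := ha 0 (by omega)
    have hj : j = j' := Sum.inl.inj h0
    subst hj
    have hbb : b = b' := by rw [Bool.eq_iff_iff, hb, hb']
    subst hbb
    have : y = y' := ih j _ y y' hy hy' (fun i hi => Sum.inr.inj (ha (i + 1) (by omega)))
      (fun n => hd n)
    rw [this]

lemma J_nonempty : ∀ k, Nonempty (J k)
  | 0 => ⟨(0 : ℕ)⟩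
  | _ + 1 => ⟨(∅ : Set _)⟩

lemma SSemb (B) : ∀ (k : ℕ) (σ : J k) (bs : List Bool), ∃ (i : ℕ) (bs' : List Bool)
    (e : (ℕ → Bool) → (ℕ → Al k)), bs'.length = k + bs.length ∧ Function.Injective e ∧
    (∀ x ∈ B (i, bs'), e x ∈ SS B k σ bs) ∧ ∀ n x x', Agree n x x' → Agree n (e x) (e x') := by
  intro k
  induction k with
  | zero => intro σ bs; exact ⟨σ, bs, id, by simp, Function.injective_id, fun x hx => hx,
      fun n x x' h => h⟩
  | succ k ih =>
    classical
    intro σ bs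
    obtain ⟨j⟩ := J_nonempty k
    obtain ⟨i, bs', e, h1, h2, h3, h4⟩ := ih j (decide (σ j) :: bs)
    refine ⟨i, bs', fun x => scons (Sum.inl j) (fun n => Sum.inr (e x n)), ?_, ?_, ?_, ?_⟩
    · rw [h1]; simp; omega
    · intro x x' h
      apply h2
      funext n
      exact Sum.inr.inj (congrFun h (n + 1))
    · intro x hx
      exact ⟨j, decide (σ j), by simp, e x, h3 x hx, rfl⟩
    · intro n x x' h m hm
      cases m with
      | zero => rfl
      | succ m => exact congrArg Sum.inr (h4 n x x' h m (by omega))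

lemma SS_nonempty {B} (hB : Diag B) (k : ℕ) (σ : J k) (bs : List Bool) :
    (SS B k σ bs).Nonempty := by
  obtain ⟨i, bs', e, -, -, h3, -⟩ := SSemb B k σ bs
  obtain ⟨x, hx⟩ := hB.1 (i, bs')
  exact ⟨e x, h3 x hx⟩

lemma same {B} (hB : Diag B) : ∀ (k : ℕ) (σ τ : J k) (bs bs' : List Bool)
    (g : (ℕ → Al k) → (ℕ → Al k)), (∀ z ∈ SS B k σ bs, g z ∈ SS B k τ bs') →
    Set.InjOn g (SS B k σ bs) →
    (∀ z ∈ SS B k σ bs, ∀ z' ∈ SS B k σ bs, ∀ n, Agree n z z' → Agree n (g z) (g z')) →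
    σ = τ ∧ bs = bs' := by
  intro k
  induction k with
  | zero =>
    intro σ τ bs bs' g hg hi hl
    by_contra hne
    obtain ⟨x, hx, hx'⟩ := hB.2 (σ, bs) 1 g
      (fun x hx x' hx' n h => hl x hx x' hx' (n + 1) h n (by omega))
      (by
        intro y
        apply Set.Subsingleton.countable
        rintro x ⟨hx, hxy⟩ x' ⟨hx', hxy'⟩
        exact hi hx hx' (hxy.trans hxy'.symm))
    refine hx' (τ, bs') ?_ (hg x hx)
    intro e
    exact hne ⟨(Prod.ext_iff.mp e).1.symm, (Prod.ext_iff.mp e).2.symm⟩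
  | succ k ih =>
    classical
    intro σ τ bs bs' g hg hi hl
    have key : ∀ j : J k, (σ j ↔ τ j) ∧ bs = bs' := by
      intro j
      obtain ⟨y0, hy0⟩ := SS_nonempty hB k j (decide (σ j) :: bs)
      let c : (ℕ → Al k) → (ℕ → Al (k + 1)) := fun y => scons (Sum.inl j) (fun n => Sum.inr (y n))
      have hc : ∀ y ∈ SS B k j (decide (σ j) :: bs), c y ∈ SS B (k + 1) σ bs := fun y hy =>
        ⟨j, decide (σ j), by simp, y, hy, rfl⟩
      obtain ⟨j', b', hb', w0, hw0, hgw0⟩ := hg _ (hc y0 hy0)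
      have hex : ∀ y ∈ SS B k j (decide (σ j) :: bs), ∃ w ∈ SS B k j' (b' :: bs'),
          g (c y) = scons (Sum.inl j') (fun n => Sum.inr (w n)) := by
        intro y hy
        obtain ⟨j2, b2, hb2, w, hw, hgw⟩ := hg _ (hc y hy)
        have h0 := hl _ (hc y hy) _ (hc y0 hy0) 1 (by
          intro i hi; obtain rfl : i = 0 := by omega
          rfl) 0 (by omega)
        rw [hgw, hgw0] at h0
        have hj : j2 = j' := Sum.inl.inj h0
        subst hj
        have hbb : b2 = b' := by rw [Bool.eq_iff_iff, hb2, hb']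
        subst hbb
        exact ⟨w, hw, hgw⟩
      choose! g' hg' hgg' using hex
      have := ih j j' (decide (σ j) :: bs) (b' :: bs') g' hg' (by
        intro y hy y' hy' h
        have h1 : g (c y) = g (c y') := by rw [hgg' y hy, hgg' y' hy', h]
        have h2 := hi (hc y hy) (hc y' hy') h1
        funext n
        exact Sum.inr.inj (congrFun h2 (n + 1))) (by
        intro y hy y' hy' n h i hi
        have h1 := hl _ (hc y hy) _ (hc y' hy') (n + 1) (by
          intro m hm
          cases m with
          | zero => rfl
          | succ m => exact congrArg Sum.inr (h m (by omega))) (i + 1) (by omega)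
        rw [hgg' y hy, hgg' y' hy'] at h1
        exact Sum.inr.inj h1)
      obtain ⟨rfl, h2⟩ := this
      rw [List.cons.injEq] at h2
      refine ⟨?_, h2.2⟩
      rw [← hb', ← h2.1]; simp
    obtain ⟨j⟩ := J_nonempty k
    refine ⟨?_, (key j).2⟩
    funext j
    exact propext (key j).1

lemma cross {B} (hB : Diag B) (k k' : ℕ) (hk : k ≠ k') (σ : J k) (τ : J k')
    (g : (ℕ → Al k) → (ℕ → Al k')) (hg : ∀ z ∈ SS B k σ [], g z ∈ SS B k' τ [])
    (hi : Set.InjOn g (SS B k σ []))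
    (hl : ∀ z ∈ SS B k σ [], ∀ z' ∈ SS B k σ [], ∀ n n', n' + k' ≤ n + k → Agree n z z' →
      Agree n' (g z) (g z')) : False := by
  obtain ⟨i, bs, e, h1, h2, h3, h4⟩ := SSemb B k σ []
  obtain ⟨x, hx, hx'⟩ := hB.2 (i, bs) (2 * k' + 1) (fun x n => dec k' (g (e x) (n + k')))
    (by
      intro x hx x' hx' n h
      have := hl _ (h3 x hx) _ (h3 x' hx') (n + (2 * k' + 1)) (n + k' + 1) (by omega)
        (h4 _ _ _ h) (n + k') (by omega)
      simp only [this])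
    (by
      intro y
      refine Set.MapsTo.countable_of_injOn (f := pre (2 * k')) (t := Set.univ)
        (fun _ _ => Set.mem_univ _) ?_ Set.countable_univ
      rintro x ⟨hx, hxy⟩ x' ⟨hx', hxy'⟩ h
      rw [pre_eq_iff] at h
      apply h2
      apply hi (h3 x hx) (h3 x' hx')
      refine SSinj B k' τ [] _ _ (hg _ (h3 x hx)) (hg _ (h3 x' hx')) ?_ ?_
      · exact hl _ (h3 x hx) _ (h3 x' hx') (2 * k') k' (by omega) (h4 _ _ _ h)
      · intro n
        exact congrFun (hxy.trans hxy'.symm) n)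
  obtain ⟨i', bs', h5, h6⟩ := SSdec B k' τ [] _ (hg _ (h3 x hx))
  refine hx' (i', bs') ?_ h6
  intro e
  have := (Prod.ext_iff.mp e).2
  simp only at this
  rw [this, h1] at h5
  simp at h5
  exact hk h5

/-- The parallel classes of subdivided edges: for each linked pair at level `n`, one for each
element of `W n`. -/
def EE {A : Type} (Lk : ℕ → A → A → Prop) (W : ℕ → Type) : Type :=
  Σ n, {p : A × A // Lk n p.1 p.2} × W n

/-- First end. -/
def EE.fst {A : Type} {Lk : ℕ → A → A → Prop} {W : ℕ → Type} (e : EE Lk W) : A := e.2.1.1.1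

/-- Second end. -/
def EE.snd {A : Type} {Lk : ℕ → A → A → Prop} {W : ℕ → Type} (e : EE Lk W) : A := e.2.1.1.2

/-- Adjacency. -/
def AdjG {A : Type} (Lk : ℕ → A → A → Prop) (W : ℕ → Type) : A ⊕ EE Lk W → A ⊕ EE Lk W → Prop
  | Sum.inl a, Sum.inr e => a = e.fst ∨ a = e.snd
  | Sum.inr e, Sum.inl a => a = e.fst ∨ a = e.snd
  | _, _ => False

/-- The subdivided multigraph. -/
def GG {A : Type} (Lk : ℕ → A → A → Prop) (W : ℕ → Type) : SimpleGraph (A ⊕ EE Lk W) where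
  Adj := AdjG Lk W
  symm := ⟨by
    rintro (a | e) (b | e') h
    · exact h
    · exact h
    · exact h
    · exact h⟩
  loopless := ⟨by
    rintro (a | e) h
    · exact h
    · exact h⟩

lemma GG_conn {A : Type} (Lk : ℕ → A → A → Prop) (W : ℕ → Type)
    (hne : ∀ n a b, Lk n a b → a ≠ b) (hW : ∀ n, Nontrivial (W n)) (r : A)
    (hr : ∀ a, Relation.ReflTransGen (fun a b => ∃ n, Lk n a b) r a)
    (a0 : A) (e0 : EE Lk W) :
    ((GG Lk W).deleteEdges {s(Sum.inl a0, Sum.inr e0)}).Connected := by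
  classical
  have h1 : ∀ e : EE Lk W, e ≠ e0 → ∀ a, (a = e.fst ∨ a = e.snd) →
      ((GG Lk W).deleteEdges {s(Sum.inl a0, Sum.inr e0)}).Adj (Sum.inl a) (Sum.inr e) := by
    intro e he a ha
    rw [SimpleGraph.deleteEdges_adj]
    refine ⟨ha, ?_⟩
    simp [he]
  have h1' : ∀ a, a ≠ a0 → ∀ e : EE Lk W, (a = e.fst ∨ a = e.snd) →
      ((GG Lk W).deleteEdges {s(Sum.inl a0, Sum.inr e0)}).Adj (Sum.inl a) (Sum.inr e) := by
    intro a hna e ha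
    rw [SimpleGraph.deleteEdges_adj]
    refine ⟨ha, ?_⟩
    simp [hna]
  have h2 : ∀ n a b, Lk n a b →
      ((GG Lk W).deleteEdges {s(Sum.inl a0, Sum.inr e0)}).Reachable (Sum.inl a) (Sum.inl b) := by
    intro n a b h
    obtain ⟨w, w', hw⟩ := (hW n).exists_pair_ne
    have : ∃ e : EE Lk W, e ≠ e0 ∧ e.fst = a ∧ e.snd = b := by
      by_cases h3 : (⟨n, ⟨(a, b), h⟩, w⟩ : EE Lk W) = e0
      · refine ⟨⟨n, ⟨(a, b), h⟩, w'⟩, ?_, rfl, rfl⟩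
        rw [← h3]
        intro h4
        have h5 := eq_of_heq (Sigma.mk.inj h4).2
        exact hw (Prod.ext_iff.mp h5).2.symm
      · exact ⟨_, h3, rfl, rfl⟩
    obtain ⟨e, he, ha, hb⟩ := this
    exact (h1 e he a (Or.inl ha.symm)).reachable.trans
      (h1 e he b (Or.inr hb.symm)).symm.reachable
  have h3 : ∀ a,
      ((GG Lk W).deleteEdges {s(Sum.inl a0, Sum.inr e0)}).Reachable (Sum.inl r) (Sum.inl a) := by
    intro a
    induction hr a with
    | refl => exact SimpleGraph.Reachable.refl _
    | tail _ h ih =>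
      obtain ⟨n, h⟩ := h
      exact ih.trans (h2 n _ _ h)
  rw [SimpleGraph.connected_iff_exists_forall_reachable]
  refine ⟨Sum.inl r, ?_⟩
  rintro (a | e)
  · exact h3 a
  · by_cases h4 : e.fst = a0
    · have h5 : e.snd ≠ a0 := by
        rw [← h4]
        exact (hne e.1 _ _ e.2.1.2).symm
      exact (h3 _).trans (h1' _ h5 e (Or.inr rfl)).reachable
    · exact (h3 _).trans (h1' _ h4 e (Or.inl rfl)).reachable

lemma GG_two {A : Type} (Lk : ℕ → A → A → Prop) (W : ℕ → Type)
    (hne : ∀ n a b, Lk n a b → a ≠ b) (hW : ∀ n, Nontrivial (W n)) (r : A)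
    (hr : ∀ a, Relation.ReflTransGen (fun a b => ∃ n, Lk n a b) r a)
    (e0 : EE Lk W) : TwoEdgeConnected (GG Lk W) := by
  refine ⟨?_, ?_, ?_⟩
  · exact (GG_conn Lk W hne hW r hr e0.fst e0).mono (SimpleGraph.deleteEdges_le _)
  · exact ⟨s(Sum.inl e0.fst, Sum.inr e0), Or.inl rfl⟩
  · intro e
    induction e with
    | _ u v =>
    intro h
    rcases u with a | e <;> rcases v with b | e'
    · exact h.elim
    · exact GG_conn Lk W hne hW r hr a e'
    · rw [Sym2.eq_swap]
      exact GG_conn Lk W hne hW r hr b e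
    · exact h.elim

lemma two_comap {X Y : Type} (d : X ≃ Y) (G : SimpleGraph Y) (h : TwoEdgeConnected G) :
    TwoEdgeConnected (G.comap d) := by
  have hc : ∀ G : SimpleGraph Y, G.Connected → (G.comap d).Connected := fun G hG =>
    (SimpleGraph.Iso.connected_iff (SimpleGraph.Iso.comap d G)).mpr hG
  refine ⟨hc G h.1, ?_, ?_⟩
  · obtain ⟨e, he⟩ := h.2.1
    induction e with
    | _ u v =>
    refine ⟨s(d.symm u, d.symm v), ?_⟩
    simpa using he
  · intro e
    induction e with
    | _ u v =>
    intro he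
    have h1 := hc _ (h.2.2 s(d u, d v) he)
    convert h1 using 1
    ext x y
    simp [SimpleGraph.deleteEdges_adj]

lemma cut {X X' Y Y' T : Type} (d : X ≃ Y) (d' : X' ≃ Y') (H : SimpleGraph Y) (G : SimpleGraph Y')
    (φ : Immersion (H.comap d) (G.comap d')) (a b : Y) (e : T → Y) (he : Function.Injective e)
    (ha : ∀ t, H.Adj a (e t)) (hb : ∀ t, H.Adj (e t) b) (U : Set Y')
    (haU : d' (φ.toFun (d.symm a)) ∈ U) (hbU : d' (φ.toFun (d.symm b)) ∉ U) :
    Cardinal.mk T ≤ Cardinal.mk {p : Y' × Y' | G.Adj p.1 p.2 ∧ p.1 ∈ U ∧ p.2 ∉ U} := by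
  have hab : a ≠ b := by rintro rfl; exact hbU haU
  have ha' : ∀ t, (H.comap d).Adj (d.symm a) (d.symm (e t)) := fun t => by simpa using ha t
  have hb' : ∀ t, (H.comap d).Adj (d.symm (e t)) (d.symm b) := fun t => by simpa using hb t
  have hex : ∀ t, ∃ D ∈ ((φ.walk (ha' t)).append (φ.walk (hb' t))).darts,
      D.fst ∈ d' ⁻¹' U ∧ D.snd ∉ d' ⁻¹' U := fun t =>
    SimpleGraph.Walk.exists_boundary_dart _ _ haU hbU
  choose D hD hD1 hD2 using hex
  have hne : ∀ t, a ≠ e t := fun t => (ha t).ne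
  have hne' : ∀ t, e t ≠ b := fun t => (hb t).ne
  have hmem : ∀ t, (D t).edge ∈ (φ.walk (ha' t)).edges ∨ (D t).edge ∈ (φ.walk (hb' t)).edges := by
    intro t
    have := hD t
    rw [SimpleGraph.Walk.darts_append, List.mem_append] at this
    rcases this with h | h
    · exact Or.inl (List.mem_map_of_mem h)
    · exact Or.inr (List.mem_map_of_mem h)
  refine Cardinal.mk_le_of_injective (f := fun t => ⟨(d' (D t).fst, d' (D t).snd),
    (D t).adj, hD1 t, hD2 t⟩) ?_
  intro t t' h
  have h0 := congrArg Subtype.val h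
  have h1 : (D t).fst = (D t').fst := d'.injective (Prod.ext_iff.mp h0).1
  have h2 : (D t).snd = (D t').snd := d'.injective (Prod.ext_iff.mp h0).2
  have h3 : (D t).edge = (D t').edge := by
    change s((D t).fst, (D t).snd) = s((D t').fst, (D t').snd)
    rw [h1, h2]
  by_contra htt
  have htt' : e t ≠ e t' := fun h => htt (he h)
  have m1 := hmem t
  have m2 := hmem t'
  rw [← h3] at m2
  rcases m1 with m1 | m1 <;> rcases m2 with m2 | m2
  · refine φ.walk_edgeDisjoint _ _ ?_ _ m1 m2
    have := hne t; have := hne t'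
    simp_all
  · refine φ.walk_edgeDisjoint _ _ ?_ _ m1 m2
    have := hne t; have := hne t'
    simp_all
  · refine φ.walk_edgeDisjoint _ _ ?_ _ m1 m2
    have := hne' t; have := hne' t'
    have := hne t; have := hne t'
    have := hab.symm
    simp_all
    exact fun h => absurd h.symm (hne t)
  · refine φ.walk_edgeDisjoint _ _ ?_ _ m1 m2
    have := hne' t; have := hne' t'
    simp_all

lemma key {A A' X X' : Type} (Lk : ℕ → A → A → Prop) (W : ℕ → Type)
    (Lk' : ℕ → A' → A' → Prop) (W' : ℕ → Type)
    (d : X ≃ A ⊕ EE Lk W) (d' : X' ≃ A' ⊕ EE Lk' W')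
    (φ : Immersion ((GG Lk W).comap d) ((GG Lk' W').comap d'))
    (hne : ∀ n a b, Lk n a b → a ≠ b)
    (hlk : ∀ a, ∃ n b, Lk n a b ∨ Lk n b a) (hW : ∀ n, Infinite (W n)) :
    ∃ f : A → A', Function.Injective f ∧ ∀ n a b, Lk n a b → ∀ (Γ : Type) (c : A' → Γ) (n' : ℕ),
      (∀ m a b, n' ≤ m → Lk' m a b → c a = c b) →
      Cardinal.mk (Bool × {e : EE Lk' W' // e.1 < n'}) < Cardinal.mk (W n) → c (f a) = c (f b) := by
  have hinjF : Function.Injective (fun y => d' (φ.toFun (d.symm y))) :=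
    d'.injective.comp (φ.injective.comp d.symm.injective)
  have hcut : ∀ n a b, Lk n a b → ∀ U : Set (A' ⊕ EE Lk' W'),
      d' (φ.toFun (d.symm (Sum.inl a))) ∈ U → d' (φ.toFun (d.symm (Sum.inl b))) ∉ U →
      Cardinal.mk (W n) ≤ Cardinal.mk {p : (A' ⊕ EE Lk' W') × (A' ⊕ EE Lk' W') |
        (GG Lk' W').Adj p.1 p.2 ∧ p.1 ∈ U ∧ p.2 ∉ U} := by
    intro n a b h U h1 h2
    refine cut d d' _ _ φ (Sum.inl a) (Sum.inl b)
      (fun w => Sum.inr (⟨n, ⟨(a, b), h⟩, w⟩ : EE Lk W)) ?_ ?_ ?_ U h1 h2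
    · intro w w' hw
      have h4 := Sum.inr.inj hw
      have h5 := eq_of_heq (Sigma.mk.inj h4).2
      exact (Prod.ext_iff.mp h5).2
    · intro w; exact Or.inl rfl
    · intro w; exact Or.inr rfl
  have hcut' : ∀ n a b, Lk n a b → ∀ U : Set (A' ⊕ EE Lk' W'),
      d' (φ.toFun (d.symm (Sum.inl b))) ∈ U → d' (φ.toFun (d.symm (Sum.inl a))) ∉ U →
      Cardinal.mk (W n) ≤ Cardinal.mk {p : (A' ⊕ EE Lk' W') × (A' ⊕ EE Lk' W') |
        (GG Lk' W').Adj p.1 p.2 ∧ p.1 ∈ U ∧ p.2 ∉ U} := by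
    intro n a b h U h1 h2
    refine cut d d' _ _ φ (Sum.inl b) (Sum.inl a)
      (fun w => Sum.inr (⟨n, ⟨(a, b), h⟩, w⟩ : EE Lk W)) ?_ ?_ ?_ U h1 h2
    · intro w w' hw
      have h4 := Sum.inr.inj hw
      have h5 := eq_of_heq (Sigma.mk.inj h4).2
      exact (Prod.ext_iff.mp h5).2
    · intro w; exact Or.inr rfl
    · intro w; exact Or.inl rfl
  have hfin : ∀ e : EE Lk' W', Set.Finite {p : (A' ⊕ EE Lk' W') × (A' ⊕ EE Lk' W') |
        (GG Lk' W').Adj p.1 p.2 ∧ p.1 ∈ ({Sum.inr e} : Set _) ∧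
          p.2 ∉ ({Sum.inr e} : Set (A' ⊕ EE Lk' W'))} := by
    intro e
    refine Set.Finite.subset (Set.toFinite {(Sum.inr e, Sum.inl e.fst), (Sum.inr e, Sum.inl e.snd)}) ?_
    rintro ⟨u, v⟩ ⟨h1, h2, h3⟩
    simp only [Set.mem_singleton_iff] at h2
    subst h2
    rcases v with b | e'
    · rcases h1 with h | h
      · left; rw [h]
      · right; rw [h]; rfl
    · exact h1.elim
  have hA : ∀ a, ∃ a', d' (φ.toFun (d.symm (Sum.inl a))) = Sum.inl a' := by
    intro a
    rcases h : d' (φ.toFun (d.symm (Sum.inl a))) with a' | e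
    · exact ⟨a', rfl⟩
    · exfalso
      obtain ⟨n, b, hb⟩ := hlk a
      have hab : a ≠ b := by
        rcases hb with hb | hb
        · exact hne _ _ _ hb
        · exact (hne _ _ _ hb).symm
      have h1 : d' (φ.toFun (d.symm (Sum.inl b))) ∉ ({Sum.inr e} : Set (A' ⊕ EE Lk' W')) := by
        intro h2
        have h3 : d' (φ.toFun (d.symm (Sum.inl b))) = d' (φ.toFun (d.symm (Sum.inl a))) := by
          rw [h]; exact h2
        exact hab (Sum.inl.inj (hinjF h3)).symm
      have h4 : Cardinal.mk (W n) < Cardinal.aleph0 := by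
        refine lt_of_le_of_lt ?_ (Cardinal.lt_aleph0_iff_set_finite.mpr (hfin e))
        rcases hb with hb | hb
        · exact hcut n a b hb _ h h1
        · exact hcut' n b a hb _ h h1
      exact absurd (Cardinal.aleph0_le_mk (W n)) (not_le.mpr h4)
  choose f hf using hA
  refine ⟨f, ?_, ?_⟩
  · intro a b h
    have : d' (φ.toFun (d.symm (Sum.inl a))) = d' (φ.toFun (d.symm (Sum.inl b))) := by
      rw [hf, hf, h]
    exact Sum.inl.inj (hinjF this)
  · intro n a b hab Γ c n' hc hlt
    by_contra hcab
    let cl : A' ⊕ EE Lk' W' → Γ := Sum.elim c (fun e => c e.fst)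
    have h1 := hcut n a b hab {y | cl y = c (f a)} (by rw [hf]; rfl)
      (by rw [hf]; exact fun h => hcab h.symm)
    refine absurd (lt_of_le_of_lt h1 (lt_of_le_of_lt ?_ hlt)) (lt_irrefl _)
    let m : Bool × {e : EE Lk' W' // e.1 < n'} → (A' ⊕ EE Lk' W') × (A' ⊕ EE Lk' W') := fun q =>
      if q.1 then (Sum.inr q.2.1, Sum.inl q.2.1.snd) else (Sum.inl q.2.1.snd, Sum.inr q.2.1)
    refine le_trans (Cardinal.mk_le_mk_of_subset (t := Set.range m) ?_) Cardinal.mk_range_le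
    have aux : ∀ e : EE Lk' W', ∀ b', (b' = e.fst ∨ b' = e.snd) → c b' ≠ c e.fst →
        b' = e.snd ∧ e.1 < n' := by
      intro e b' h h2
      rcases h with rfl | rfl
      · exact absurd rfl h2
      · refine ⟨rfl, ?_⟩
        by_contra h3
        exact h2 (hc e.1 _ _ (not_lt.mp h3) e.2.1.2).symm
    rintro ⟨u, v⟩ ⟨h2, h3, h4⟩
    rcases u with a1 | e1 <;> rcases v with a2 | e2
    · exact h2.elim
    · obtain ⟨rfl, h6⟩ := aux e2 a1 h2 (fun h => h4 (h.symm.trans h3))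
      exact ⟨(false, ⟨e2, h6⟩), rfl⟩
    · obtain ⟨rfl, h6⟩ := aux e1 a2 h2 (fun h => h4 (h.trans h3))
      exact ⟨(true, ⟨e1, h6⟩), rfl⟩
    · exact h2.elim

lemma J_succ (m : ℕ) : Cardinal.mk (J (m + 1)) = 2 ^ Cardinal.mk (J m) := Cardinal.mk_set

lemma J_lt (m : ℕ) : Cardinal.mk (J m) < Cardinal.mk (J (m + 1)) := by
  rw [J_succ]; exact Cardinal.cantor _

lemma J_mono {m n : ℕ} (h : m ≤ n) : Cardinal.mk (J m) ≤ Cardinal.mk (J n) :=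
  monotone_nat_of_le_succ (f := fun m => Cardinal.mk (J m)) (fun m => (J_lt m).le) h

lemma J_inf (m : ℕ) : Cardinal.aleph0 ≤ Cardinal.mk (J m) :=
  le_trans (by change Cardinal.aleph0 ≤ Cardinal.mk ℕ; simp) (J_mono (Nat.zero_le m))

lemma Al_le : ∀ k, Cardinal.mk (Al k) ≤ Cardinal.mk (J k)
  | 0 => by
    refine le_trans ?_ (J_inf 0)
    change Cardinal.mk Bool ≤ _
    exact Cardinal.mk_le_aleph0
  | k + 1 => by
    change Cardinal.mk (J k ⊕ Al k) ≤ _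
    rw [Cardinal.mk_sum, Cardinal.lift_id, Cardinal.lift_id]
    exact Cardinal.add_le_of_le (J_inf _) (J_lt k).le ((Al_le k).trans (J_lt k).le)

lemma Al_nonempty : ∀ k, Nonempty (Al k)
  | 0 => ⟨(true : Bool)⟩
  | k + 1 => (J_nonempty k).map Sum.inl

lemma list_le (k : ℕ) : Cardinal.mk (List (Al k)) ≤ Cardinal.mk (J k) :=
  (Cardinal.mk_list_le_max _).trans (max_le (J_inf k) (Al_le k))

lemma fun_le (k : ℕ) : Cardinal.mk (ℕ → Al k) ≤ Cardinal.mk (J (k + 1)) := by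
  rw [J_succ]
  have : Cardinal.mk (ℕ → Al k) = Cardinal.mk (Al k) ^ Cardinal.aleph0 := by simp
  rw [this]
  calc Cardinal.mk (Al k) ^ Cardinal.aleph0 ≤ (2 ^ Cardinal.mk (J k)) ^ Cardinal.aleph0 :=
        Cardinal.power_le_power_right ((Al_le k).trans (Cardinal.cantor _).le)
    _ = 2 ^ Cardinal.mk (J k) := by
        rw [← Cardinal.power_mul, Cardinal.mul_eq_left (J_inf k) (J_inf k) Cardinal.aleph0_ne_zero]

/-- Vertices of the tree with tops. -/
def AA (B : ℕ × List Bool → Set (ℕ → Bool)) (k : ℕ) (σ : J k) : Type :=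
  List (Al k) ⊕ SS B k σ []

lemma AA_le (B k σ) : Cardinal.mk (AA B k σ) ≤ Cardinal.mk (J (k + 1)) := by
  change Cardinal.mk (List (Al k) ⊕ SS B k σ []) ≤ _
  rw [Cardinal.mk_sum, Cardinal.lift_id, Cardinal.lift_id]
  exact Cardinal.add_le_of_le (J_inf _) ((list_le k).trans (J_lt k).le)
    ((Cardinal.mk_set_le _).trans (fun_le k))

/-- Links. -/
def LL (B : ℕ × List Bool → Set (ℕ → Bool)) (k : ℕ) (σ : J k) (n : ℕ) : AA B k σ → AA B k σ → Prop
  | Sum.inl t, Sum.inl t' => t.length = n ∧ ∃ a, t' = t ++ [a]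
  | Sum.inl t, Sum.inr z => t = pre n z.1
  | Sum.inr _, _ => False

/-- Weights. -/
def WW (k n : ℕ) : Type := J (k + 2 + n)

/-- Truncation. -/
def cc (B : ℕ × List Bool → Set (ℕ → Bool)) (k : ℕ) (σ : J k) (n : ℕ) : AA B k σ → List (Al k)
  | Sum.inl t => t.take n
  | Sum.inr z => pre n z.1

lemma cc_eq (B k σ) (n m : ℕ) (a b : AA B k σ) (h : n ≤ m) (hl : LL B k σ m a b) :
    cc B k σ n a = cc B k σ n b := by
  rcases a with t | z
  · rcases b with t' | z'
    · obtain ⟨h1, x, rfl⟩ := hl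
      change t.take n = (t ++ [x]).take n
      rw [List.take_append_of_le_length (by omega)]
    · have h1 : t = pre m z'.1 := hl
      change t.take n = pre n z'.1
      rw [h1, pre_take h]
  · exact hl.elim

lemma LL_ne (B k σ) (n : ℕ) (a b : AA B k σ) (h : LL B k σ n a b) : a ≠ b := by
  rintro rfl
  rcases a with t | z
  · obtain ⟨-, x, h2⟩ := h
    have := congrArg List.length h2
    simp at this
  · exact h

lemma LL_root (B k σ) (a : AA B k σ) :
    Relation.ReflTransGen (fun a b => ∃ n, LL B k σ n a b) (Sum.inl []) a := by
  rcases a with t | z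
  · induction t using List.reverseRecOn with
    | nil => exact Relation.ReflTransGen.refl
    | append_singleton t x ih => exact ih.tail ⟨t.length, rfl, x, rfl⟩
  · exact Relation.ReflTransGen.single ⟨0, rfl⟩

lemma LL_lk (B k σ) (a : AA B k σ) : ∃ n b, LL B k σ n a b ∨ LL B k σ n b a := by
  rcases a with t | z
  · obtain ⟨x⟩ := Al_nonempty k
    exact ⟨t.length, Sum.inl (t ++ [x]), Or.inl ⟨rfl, x, rfl⟩⟩
  · exact ⟨0, Sum.inl [], Or.inr rfl⟩

lemma WW_inf (k n : ℕ) : Infinite (WW k n) := Cardinal.infinite_iff.mpr (J_inf _)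

lemma low_lt (B k σ) (n : ℕ) :
    Cardinal.mk (Bool × {e : EE (LL B k σ) (WW k) // e.1 < n}) < Cardinal.mk (J (k + 2 + n)) := by
  have hk : k + 2 + n = (k + 1 + n) + 1 := by omega
  rw [hk]
  refine lt_of_le_of_lt ?_ (J_lt _)
  set κ := Cardinal.mk (J (k + 1 + n)) with hκ
  have hκ0 : Cardinal.aleph0 ≤ κ := J_inf _
  have hA : Cardinal.mk (AA B k σ) ≤ κ := (AA_le B k σ).trans (J_mono (by omega))
  have hS : Cardinal.mk (Σ m : Fin n, J (k + 2 + m.1)) ≤ κ := by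
    rw [Cardinal.mk_sigma]
    refine (Cardinal.sum_le_sum _ (fun _ : Fin n => κ) (fun m => J_mono (by omega))).trans ?_
    rw [Cardinal.sum_const, Cardinal.lift_id, Cardinal.lift_id]
    exact Cardinal.mul_le_of_le hκ0 (Cardinal.mk_le_aleph0.trans hκ0) le_rfl
  have hE : Cardinal.mk {e : EE (LL B k σ) (WW k) // e.1 < n} ≤
      Cardinal.mk ((AA B k σ × AA B k σ) × (Σ m : Fin n, J (k + 2 + m.1))) := by
    refine Cardinal.mk_le_of_injective (f := fun e => ((e.1.2.1.1), ⟨⟨e.1.1, e.2⟩, e.1.2.2⟩)) ?_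
    rintro ⟨⟨m, ⟨p, hp⟩, w⟩, h⟩ ⟨⟨m', ⟨p', hp'⟩, w'⟩, h'⟩ he
    obtain ⟨h1, h2⟩ := Prod.ext_iff.mp he
    obtain rfl : p = p' := h1
    obtain ⟨h3, hw⟩ := Sigma.mk.inj h2
    obtain rfl : m = m' := congrArg Fin.val h3
    obtain rfl : w = w' := eq_of_heq hw
    rfl
  rw [Cardinal.mk_prod, Cardinal.lift_id, Cardinal.lift_id]
  refine Cardinal.mul_le_of_le hκ0 (Cardinal.mk_le_aleph0.trans hκ0) (hE.trans ?_)
  simp only [Cardinal.mk_prod, Cardinal.lift_id]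
  exact Cardinal.mul_le_of_le hκ0 (Cardinal.mul_le_of_le hκ0 hA hA) hS

lemma main_eq {B} (hB : Diag B) (k k' : ℕ) (σ : J k) (τ : J k') {X X' : Type}
    (d : X ≃ AA B k σ ⊕ EE (LL B k σ) (WW k)) (d' : X' ≃ AA B k' τ ⊕ EE (LL B k' τ) (WW k'))
    (h : Immersed ((GG (LL B k σ) (WW k)).comap d) ((GG (LL B k' τ) (WW k')).comap d')) :
    (⟨k, σ⟩ : Σ k, J k) = ⟨k', τ⟩ := by
  classical
  obtain ⟨φ⟩ := h
  obtain ⟨f, hf, hfc⟩ := key _ _ _ _ d d' φ (LL_ne B k σ) (LL_lk B k σ) (WW_inf k)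
  have hc : ∀ n n' a b, n' + k' ≤ n + k → LL B k σ n a b →
      cc B k' τ n' (f a) = cc B k' τ n' (f b) := by
    intro n n' a b hn hab
    refine hfc n a b hab _ (cc B k' τ n') n' (fun m a b hm hl => cc_eq B k' τ n' m a b hm hl) ?_
    exact lt_of_lt_of_le (low_lt B k' τ n') (J_mono (by omega))
  have htop : ∀ z : SS B k σ [], ∃ y : SS B k' τ [], f (Sum.inr z) = Sum.inr y := by
    intro z
    rcases h : f (Sum.inr z) with s | y
    · exfalso
      have h1 := hc (s.length + 1 + k') (s.length + 1) (Sum.inl (pre (s.length + 1 + k') z.1))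
        (Sum.inr z) (by omega) rfl
      rw [h] at h1
      rcases h2 : f (Sum.inl (pre (s.length + 1 + k') z.1)) with s' | y'
      · rw [h2] at h1
        change s'.take (s.length + 1) = s.take (s.length + 1) at h1
        rw [List.take_of_length_le (by omega : s.length ≤ s.length + 1)] at h1
        have h3 : s'.length ≤ s.length + 1 := by
          have := congrArg List.length h1
          rw [List.length_take] at this
          omega
        rw [List.take_of_length_le h3] at h1
        rw [h1, ← h] at h2
        exact absurd (hf h2) (by simp)
      · rw [h2] at h1
        change pre (s.length + 1) y'.1 = s.take (s.length + 1) at h1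
        have := congrArg List.length h1
        rw [List.length_take, pre_length] at this
        omega
    · exact ⟨y, rfl⟩
  choose g hg using htop
  have hginj : Function.Injective g := by
    intro z z' h
    have : f (Sum.inr z) = f (Sum.inr z') := by rw [hg, hg, h]
    exact Sum.inr.inj (hf this)
  have hgl : ∀ z z' : SS B k σ [], ∀ n n', n' + k' ≤ n + k → Agree n z.1 z'.1 →
      Agree n' (g z).1 (g z').1 := by
    intro z z' n n' hn hz
    rw [← pre_eq_iff] at hz ⊢
    have h1 := hc n n' (Sum.inl (pre n z.1)) (Sum.inr z) hn rfl
    have h2 := hc n n' (Sum.inl (pre n z'.1)) (Sum.inr z') hn rfl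
    rw [hz, h2, hg, hg] at h1
    exact h1.symm
  obtain ⟨y0⟩ := Al_nonempty k'
  let G : (ℕ → Al k) → (ℕ → Al k') := fun z => if hz : z ∈ SS B k σ [] then (g ⟨z, hz⟩).1 else
    fun _ => y0
  have hG : ∀ z (hz : z ∈ SS B k σ []), G z = (g ⟨z, hz⟩).1 := fun z hz => dif_pos hz
  have hG1 : ∀ z ∈ SS B k σ [], G z ∈ SS B k' τ [] := fun z hz => by
    rw [hG z hz]; exact (g ⟨z, hz⟩).2
  have hG2 : Set.InjOn G (SS B k σ []) := by
    intro z hz z' hz' h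
    rw [hG z hz, hG z' hz'] at h
    exact congrArg Subtype.val (hginj (Subtype.ext h))
  have hG3 : ∀ z ∈ SS B k σ [], ∀ z' ∈ SS B k σ [], ∀ n n', n' + k' ≤ n + k → Agree n z z' →
      Agree n' (G z) (G z') := by
    intro z hz z' hz' n n' hn h
    rw [hG z hz, hG z' hz']
    exact hgl _ _ n n' hn h
  by_cases hk : k = k'
  · subst hk
    rw [(same hB k σ τ [] [] G hG1 hG2
      (fun z hz z' hz' n h => hG3 z hz z' hz' n n le_rfl h)).1]
  · exact (cross hB k k' hk σ τ G hG1 hG2 hG3).elim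

lemma J_le_index (m : ℕ) : Cardinal.mk (J m) ≤ Cardinal.mk (Σ k, J k) :=
  Cardinal.mk_le_of_injective (f := fun x => ⟨m, x⟩) sigma_mk_injective

lemma vert_le (B k σ) :
    Cardinal.mk (AA B k σ ⊕ EE (LL B k σ) (WW k)) ≤ Cardinal.mk (Σ k, J k) := by
  set κ := Cardinal.mk (Σ k, J k) with hκ
  have hκ0 : Cardinal.aleph0 ≤ κ := (J_inf 0).trans (J_le_index 0)
  have hA : Cardinal.mk (AA B k σ) ≤ κ := (AA_le B k σ).trans (J_le_index _)
  have hE : Cardinal.mk (EE (LL B k σ) (WW k)) ≤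
      Cardinal.mk ((AA B k σ × AA B k σ) × (Σ k, J k)) := by
    refine Cardinal.mk_le_of_injective (f := fun e => ((e.2.1.1), ⟨k + 2 + e.1, e.2.2⟩)) ?_
    rintro ⟨m, ⟨p, hp⟩, w⟩ ⟨m', ⟨p', hp'⟩, w'⟩ he
    obtain ⟨h1, h2⟩ := Prod.ext_iff.mp he
    obtain rfl : p = p' := h1
    obtain ⟨h3, hw⟩ := Sigma.mk.inj h2
    obtain rfl : m = m' := Nat.add_left_cancel h3
    obtain rfl : w = w' := eq_of_heq hw
    rfl
  simp only [Cardinal.mk_sum, Cardinal.lift_id]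
  refine Cardinal.add_le_of_le hκ0 hA (hE.trans ?_)
  simp only [Cardinal.mk_prod, Cardinal.lift_id]
  exact Cardinal.mul_le_of_le hκ0 (Cardinal.mul_le_of_le hκ0 hA hA) le_rfl

end Blob

/-- There is an infinite family `𝓗` of pairwise vertex-disjoint infinite 2-edge-connected
graphs, each with at most `|𝓗|` vertices, forming an antichain under immersion. -/
theorem exists_infinite_immersion_antichain_of_blobs :
    ∃ (U ι : Type) (s : ι → Set U) (Gr : ∀ i : ι, SimpleGraph (s i)),
      Infinite ι ∧
      (∀ i j : ι, i ≠ j → Disjoint (s i) (s j)) ∧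
      (∀ i : ι, (s i).Infinite) ∧
      (∀ i : ι, TwoEdgeConnected (Gr i)) ∧
      (∀ i : ι, Cardinal.mk (s i) ≤ Cardinal.mk ι) ∧
      (∀ i j : ι, i ≠ j → ¬ Immersed (Gr i) (Gr j)) := by
  classical
  obtain ⟨B, hB⟩ := Blob.exists_Diag
  let V : (Σ k, Blob.J k) → Type := fun i =>
    Blob.AA B i.1 i.2 ⊕ Blob.EE (Blob.LL B i.1 i.2) (Blob.WW i.1)
  let s : (Σ k, Blob.J k) → Set (Σ i, V i) := fun i => Set.range (Sigma.mk i)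
  let d : ∀ i, s i ≃ V i := fun i => (Equiv.ofInjective (Sigma.mk i) sigma_mk_injective).symm
  refine ⟨Σ i, V i, Σ k, Blob.J k, s,
    fun i => (Blob.GG (Blob.LL B i.1 i.2) (Blob.WW i.1)).comap (d i), ?_, ?_, ?_, ?_, ?_, ?_⟩
  · exact Cardinal.infinite_iff.mpr ((Blob.J_inf 0).trans (Blob.J_le_index 0))
  · intro i j hij
    rw [Set.disjoint_left]
    rintro _ ⟨x, rfl⟩ ⟨y, hy⟩
    exact hij (Sigma.mk.inj hy).1.symm
  · intro i
    haveI : Nonempty (Blob.Al i.1) := Blob.Al_nonempty i.1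
    haveI : Infinite (V i) :=
      Infinite.of_injective (fun t : List (Blob.Al i.1) => (Sum.inl (Sum.inl t) : V i))
        (fun a b h => Sum.inl.inj (Sum.inl.inj h))
    exact Set.infinite_range_of_injective sigma_mk_injective
  · intro i
    apply Blob.two_comap
    haveI := Blob.WW_inf i.1
    obtain ⟨x⟩ := Blob.Al_nonempty i.1
    refine Blob.GG_two _ _ (Blob.LL_ne B i.1 i.2) (fun n => inferInstance) (Sum.inl [])
      (Blob.LL_root B i.1 i.2)
      ⟨0, ⟨(Sum.inl [], Sum.inl [x]), rfl, x, rfl⟩, Classical.arbitrary _⟩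
  · intro i
    rw [Cardinal.mk_congr (d i)]
    exact Blob.vert_le B i.1 i.2
  · intro i j hij h
    exact hij (Blob.main_eq hB i.1 j.1 i.2 j.2 (d i) (d j) h)
end

section
/- There exist infinite graphs G₁ and G₂ and an infinite set 𝓕 of infinite graphs such that: (IT1) 𝓕 is an antichain with respect to the immersion relation; (IT2) every graph in 𝓕 is connected; (IT3) both G₁ and G₂ are subgraphs of each graph in 𝓕 (up to isomorphism); and (IT4) for every G in 𝓕 and every graph G' properly immersed in G, G₁ is not immersed in G' or G₂ is not immersed in G'. -/
open SimpleGraph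

namespace ITX
open Cardinal

lemma sel_aux {I Z : Type} [Infinite Z] (hI : #I ≤ #Z) (P : I → Z → Z → Prop)
    (h : ∀ i (A : Set Z), #A < #Z → ∃ z w, P i z w ∧ z ∉ A ∧ w ∉ A ∧ z ≠ w) :
    ∃ z w : I → Z, (∀ i, P i (z i) (w i)) ∧ (∀ i j, z i ≠ w j) ∧ Function.Injective z := by
  classical
  obtain ⟨r, wo, hr⟩ := Cardinal.exists_ord_eq I
  have hlt : ∀ i, #{j // r j i} < #Z := by
    intro i
    refine lt_of_lt_of_le ?_ hI
    exact Cardinal.card_typein_lt i hr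
  let Aof : (i : I) → ((j : I) → r j i → Z × Z) → Set Z := fun i g =>
    Set.range (fun j : {j // r j i} => (g j.1 j.2).1) ∪ Set.range (fun j : {j // r j i} => (g j.1 j.2).2)
  have hA : ∀ i g, #(Aof i g) < #Z := by
    intro i g
    refine lt_of_le_of_lt (Cardinal.mk_union_le _ _) ?_
    apply Cardinal.add_lt_of_lt (Cardinal.aleph0_le_mk Z)
    · exact lt_of_le_of_lt Cardinal.mk_range_le (hlt i)
    · exact lt_of_le_of_lt Cardinal.mk_range_le (hlt i)
  choose zz ww h1 h2 h3 h4 using fun i g => h i (Aof i g) (hA i g)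
  let G : I → Z × Z := wo.wf.fix (fun i g => (zz i g, ww i g))
  have hG : ∀ i, G i = (zz i (fun j _ => G j), ww i (fun j _ => G j)) := fun i => wo.wf.fix_eq _ i
  have key : ∀ i j, r j i → (G i).1 ≠ (G j).1 ∧ (G i).1 ≠ (G j).2 ∧ (G i).2 ≠ (G j).1 := by
    intro i j hji
    have e1 : (G i).1 = zz i (fun j _ => G j) := by rw [hG i]
    have e2 : (G i).2 = ww i (fun j _ => G j) := by rw [hG i]
    have m1 : (G j).1 ∈ Aof i (fun j _ => G j) := Or.inl ⟨⟨j, hji⟩, rfl⟩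
    have m2 : (G j).2 ∈ Aof i (fun j _ => G j) := Or.inr ⟨⟨j, hji⟩, rfl⟩
    refine ⟨?_, ?_, ?_⟩
    · intro he; apply h2 i (fun j _ => G j); rw [← e1, he]; exact m1
    · intro he; apply h2 i (fun j _ => G j); rw [← e1, he]; exact m2
    · intro he; apply h3 i (fun j _ => G j); rw [← e2, he]; exact m1
  refine ⟨fun i => (G i).1, fun i => (G i).2, ?_, ?_, ?_⟩
  · intro i
    have := h1 i (fun j _ => G j)
    have e1 : (G i).1 = zz i (fun j _ => G j) := by rw [hG i]
    have e2 : (G i).2 = ww i (fun j _ => G j) := by rw [hG i]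
    rw [← e1, ← e2] at this; exact this
  · intro i j
    rcases trichotomous_of r i j with hij | rfl | hij
    · exact fun he => (key j i hij).2.2 he.symm
    · have := h4 i (fun j _ => G j)
      have e1 : (G i).1 = zz i (fun j _ => G j) := by rw [hG i]
      have e2 : (G i).2 = ww i (fun j _ => G j) := by rw [hG i]
      rw [← e1, ← e2] at this; exact this
    · exact (key i j hij).2.1
  · intro i j he
    rcases trichotomous_of r i j with hij | rfl | hij
    · exact absurd he.symm (key j i hij).1
    · rfl
    · exact absurd he (key i j hij).1

def pre (x : ℕ → Bool) (n : ℕ) : List Bool := (List.range n).map x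

lemma pre_length (x n) : (pre x n).length = n := by simp [pre]
lemma pre_eq_iff {x y : ℕ → Bool} {n} : pre x n = pre y n ↔ ∀ i < n, x i = y i := by
  simp [pre, List.map_inj_left]
lemma pre_take (x) {m n : ℕ} (h : m ≤ n) : (pre x n).take m = pre x m := by
  simp [pre, ← List.map_take, List.take_range, h]
lemma pre_mono {x y : ℕ → Bool} {m n : ℕ} (h : m ≤ n) (e : pre x n = pre y n) : pre x m = pre y m := by
  rw [pre_eq_iff] at *; exact fun i hi => e i (by omega)

def cyl (s : List Bool) : Set (ℕ → Bool) := {x | pre x s.length = s}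

lemma cyl_ne (s : List Bool) : ∃ g : (ℕ → Bool) → (ℕ → Bool), Function.Injective g ∧ ∀ z, g z ∈ cyl s := by
  refine ⟨fun z i => if h : i < s.length then s[i] else z (i - s.length), ?_, ?_⟩
  · intro z z' h
    funext i
    have := congrFun h (i + s.length)
    simpa using this
  · intro z
    simp only [cyl, Set.mem_ofPred_eq, pre]
    apply List.ext_getElem
    · simp
    · intro i h1 h2
      simp at h1
      simp [h1]

end ITX

namespace ITX
open Cardinal

lemma mem_cyl_pre {x y : ℕ → Bool} {n} : y ∈ cyl (pre x n) ↔ pre y n = pre x n := by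
  simp [cyl, pre_length]

def ext (G : List Bool → Bool) (z : ℕ → Bool) : ℕ → Bool := fun i => G (pre z (i+1))

def rset (G : List Bool → Bool) (s : List Bool) : Set (ℕ → Bool) :=
  {y | ∃ z ∈ cyl s, ext G z = y ∧ z ≠ y}

def tsk (i : (List Bool → Bool) × List Bool) (z w : ℕ → Bool) : Prop :=
  z ∈ cyl i.2 ∧ (#(ℕ → Bool) ≤ #(rset i.1 i.2) → w = ext i.1 z)

lemma tsk_sel (i) (A : Set (ℕ → Bool)) (hA : #A < #(ℕ → Bool)) :
    ∃ z w, tsk i z w ∧ z ∉ A ∧ w ∉ A ∧ z ≠ w := by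
  classical
  obtain ⟨G, s⟩ := i
  by_cases hr : #(ℕ → Bool) ≤ #(rset G s)
  · have hz : ∀ y : rset G s, ∃ z ∈ cyl s, ext G z = y.1 ∧ z ≠ y.1 := fun y => y.2
    choose ζ h1 h2 h3 using hz
    have hζ : Function.Injective ζ := by
      intro y y' h; apply Subtype.ext; rw [← h2 y, ← h2 y', h]
    by_contra hcon
    have hall : ∀ y : rset G s, ζ y ∈ A ∨ y.1 ∈ A := by
      intro y
      by_contra hy
      push Not at hy
      exact hcon ⟨ζ y, y.1, ⟨h1 y, fun _ => (h2 y).symm⟩, hy.1, hy.2, h3 y⟩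
    have hinj : Function.Injective
        (fun y : rset G s => if h : ζ y ∈ A then (Sum.inl ⟨ζ y, h⟩ : A ⊕ A)
          else Sum.inr ⟨y.1, (hall y).resolve_left h⟩) := by
      intro y y' h
      dsimp only at h
      split_ifs at h with h1 h2 h2
      · simp only [Sum.inl.injEq, Subtype.mk.injEq] at h; exact hζ h
      · simp only [Sum.inr.injEq, Subtype.mk.injEq] at h; exact Subtype.ext h
    have := Cardinal.mk_le_of_injective hinj
    rw [← Cardinal.add_def] at this
    exact absurd (hr.trans this) (not_le.mpr (Cardinal.add_lt_of_lt (Cardinal.aleph0_le_mk _) hA hA))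
  · obtain ⟨g, hg, hg'⟩ := cyl_ne s
    have : ∃ z, g z ∉ A := by
      by_contra hcon
      push Not at hcon
      exact absurd (Cardinal.mk_le_of_injective (f := fun z => (⟨g z, hcon z⟩ : A))
        (fun a b h => hg (by simpa using h))) (not_le.mpr hA)
    obtain ⟨z, hz⟩ := this
    have : ∃ w, w ∉ A ∪ {g z} := by
      by_contra hcon
      push Not at hcon
      have h1 : #(ℕ → Bool) ≤ #(A ∪ {g z} : Set (ℕ → Bool)) :=
        Cardinal.mk_le_of_injective (f := fun z => ⟨z, hcon z⟩) (fun a b h => by simpa using h)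
      refine absurd (h1.trans (Cardinal.mk_union_le _ _)) (not_le.mpr ?_)
      apply Cardinal.add_lt_of_lt (Cardinal.aleph0_le_mk _) hA
      rw [Cardinal.mk_singleton]
      exact Cardinal.one_lt_aleph0.trans_le (Cardinal.aleph0_le_mk _)
    obtain ⟨w, hw⟩ := this
    simp only [Set.mem_union, Set.mem_singleton_iff, not_or] at hw
    exact ⟨g z, w, ⟨hg' z, fun h => absurd h hr⟩, hz, hw.1, fun h => hw.2 h.symm⟩

theorem dm : ∃ X : Set (ℕ → Bool),
    (∀ s, ∃ g : (ℕ → Bool) → (ℕ → Bool), Function.Injective g ∧ ∀ z, g z ∈ X ∧ g z ∈ cyl s) ∧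
    ∀ f : (ℕ → Bool) → (ℕ → Bool), (∀ x ∈ X, f x ∈ X) → (∀ x ∈ X, ∀ y ∈ X, f x = f y → x = y) →
      (∀ x ∈ X, ∀ y ∈ X, ∀ n, pre x n = pre y n → pre (f x) n = pre (f y) n) → ∀ x ∈ X, f x = x := by
  classical
  have hc : #((List Bool → Bool) × List Bool) ≤ #(ℕ → Bool) := by
    simp [Cardinal.mk_prod]
  obtain ⟨z, w, hP, hzw, hz⟩ := sel_aux hc tsk tsk_sel
  have hden : ∀ s, ∃ g : (ℕ → Bool) → (ℕ → Bool), Function.Injective g ∧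
      ∀ y, g y ∈ Set.range z ∧ g y ∈ cyl s := by
    intro s
    refine ⟨fun x => z (fun l => x l.length, s), ?_, fun x => ⟨⟨_, rfl⟩, (hP _).1⟩⟩
    intro x y h
    have := hz h
    simp only [Prod.mk.injEq, and_true] at this
    funext n
    simpa using congrFun this (List.replicate n true)
  refine ⟨Set.range z, hden, ?_⟩
  intro f hf hinj hlip x0 hx0
  by_contra hne
  obtain ⟨n, hn⟩ := Function.ne_iff.mp hne
  let G : List Bool → Bool := fun l =>
    if h : ∃ x, x ∈ Set.range z ∧ x ∈ cyl l then f h.choose (l.length - 1) else false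
  have hG : ∀ y ∈ Set.range z, ext G y = f y := by
    intro y hy
    funext i
    have hex : ∃ x, x ∈ Set.range z ∧ x ∈ cyl (pre y (i+1)) := ⟨y, hy, mem_cyl_pre.2 rfl⟩
    have h2 := hex.choose_spec
    have h3 := hlip _ h2.1 y hy (i+1) (mem_cyl_pre.1 h2.2)
    simp only [ext, G, dif_pos hex, pre_length]
    exact pre_eq_iff.1 h3 i (by omega)
  set s := pre x0 (n+1) with hs
  have hmove : ∀ y ∈ cyl s, y ≠ ext G y := by
    intro y hy he
    have h1 : pre y (n+1) = pre x0 (n+1) := mem_cyl_pre.1 hy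
    have h2 : ext G y n = ext G x0 n := by simp only [ext]; rw [h1]
    rw [hG x0 hx0, ← he, pre_eq_iff.1 h1 n (by omega)] at h2
    exact hn h2.symm
  have hrich : #(ℕ → Bool) ≤ #(rset G s) := by
    obtain ⟨g, hg, hg'⟩ := hden s
    refine Cardinal.mk_le_of_injective (f := fun y => ⟨ext G (g y), g y, (hg' y).2, rfl, hmove _ (hg' y).2⟩) ?_
    intro a b h
    replace h : ext G (g a) = ext G (g b) := congrArg Subtype.val h
    rw [hG _ (hg' a).1, hG _ (hg' b).1] at h
    exact hg (hinj _ (hg' a).1 _ (hg' b).1 h)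
  have h1 := (hP (G, s)).2 hrich
  have h2 : ext G (z (G, s)) = f (z (G, s)) := hG _ ⟨_, rfl⟩
  obtain ⟨k, hk⟩ := hf (z (G, s)) ⟨_, rfl⟩
  exact hzw k (G, s) (by rw [hk, h1, h2])

end ITX

namespace ITX
open Cardinal

lemma exists_code (Y : Type) [Infinite Y] : ∃ code : Set Y → Set Y,
    (∀ P Q, code P ⊆ code Q → P = Q) ∧ ∀ P, #(code P) = #Y := by
  classical
  have h : #(Y ⊕ Y) = #Y := by
    rw [Cardinal.mk_sum]; simp [Cardinal.add_eq_self (Cardinal.aleph0_le_mk Y)]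
  obtain ⟨e⟩ := Cardinal.eq.1 h
  refine ⟨fun P => Set.range (fun y => if y ∈ P then e (Sum.inl y) else e (Sum.inr y)), ?_, ?_⟩
  · intro P Q hPQ
    ext y
    obtain ⟨y', hy'⟩ := hPQ ⟨y, rfl⟩
    dsimp only at hy'
    split_ifs at hy' with h1 h2 h2 <;> have := e.injective hy' <;> simp at this <;> subst this <;> simp [h1, h2]
  · intro P
    apply Cardinal.mk_range_eq
    intro y y' hy
    dsimp only at hy
    split_ifs at hy with h1 h2 h2 <;> have := e.injective hy <;> simpa using this

structure Tower where
  N : Type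
  rank : N → ℕ
  child : N → N → Prop
  κ : ℕ → Cardinal.{0}
  κ_mono : StrictMono κ
  κ_zero : κ 0 = #(ℕ → Bool)
  card_rank : ∀ i, #{q // rank q = i} = κ i
  card_child : ∀ p, 1 ≤ rank p → #{q // child p q} = κ (rank p - 1)
  child_rank : ∀ p q, child p q → rank p = rank q + 1
  antichain : ∀ p p', 1 ≤ rank p → rank p = rank p' → (∀ q, child p q → child p' q) → p = p'

def Nt : ℕ → Type
  | 0 => ℕ → Bool
  | (j+1) => Set (Nt j)

lemma Nt_inf : ∀ j, Infinite (Nt j)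
  | 0 => inferInstanceAs (Infinite (ℕ → Bool))
  | (j+1) => by
    have := Nt_inf j
    exact inferInstanceAs (Infinite (Set (Nt j)))

theorem tower_exists : Nonempty Tower := by
  classical
  have hc : ∀ j, ∃ code : Set (Nt j) → Set (Nt j),
    (∀ P Q, code P ⊆ code Q → P = Q) ∧ ∀ P, #(code P) = #(Nt j) := fun j => by
      have := Nt_inf j
      exact exists_code _
  choose code h1 h2 using hc
  let child : (Σ j, Nt j) → (Σ j, Nt j) → Prop := fun p q =>
    ∃ (j : ℕ) (S : Set (Nt j)) (a : Nt j), p = ⟨j+1, S⟩ ∧ q = ⟨j, a⟩ ∧ a ∈ code j S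
  have hch : ∀ (j : ℕ) (S : Set (Nt j)) (a : Nt j), child ⟨j+1, S⟩ ⟨j, a⟩ ↔ a ∈ code j S := by
    intro j S a
    constructor
    · rintro ⟨j', S', a', h, h', ha⟩
      obtain ⟨rfl, h'⟩ := Sigma.mk.inj_iff.1 h'
      obtain ⟨_, h⟩ := Sigma.mk.inj_iff.1 h
      rw [eq_of_heq h', eq_of_heq h]; exact ha
    · intro ha
      exact ⟨j, S, a, rfl, rfl, ha⟩
  refine ⟨⟨Σ j, Nt j, Sigma.fst, child, fun j => #(Nt j), ?_, rfl, ?_, ?_, ?_, ?_⟩⟩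
  · apply strictMono_nat_of_lt_succ
    intro j
    show #(Nt j) < #(Set (Nt j))
    rw [Cardinal.mk_set]; exact Cardinal.cantor _
  · intro i
    refine Cardinal.mk_congr ⟨fun q => q.2 ▸ q.1.2, fun a => ⟨⟨i, a⟩, rfl⟩, ?_, ?_⟩
    · rintro ⟨⟨j, a⟩, rfl⟩; rfl
    · intro a; rfl
  · rintro ⟨j, S⟩ hj
    cases j with
    | zero => simp at hj
    | succ j =>
      change Set (Nt j) at S
      simp only [Nat.add_sub_cancel]
      rw [← h2 j S]
      refine (Cardinal.mk_congr (Equiv.ofBijective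
        (fun a : code j S => (⟨⟨j, a.1⟩, (hch j S a.1).2 a.2⟩ : {q // child ⟨j+1, S⟩ q})) ⟨?_, ?_⟩)).symm
      · intro a b h
        simp only [Subtype.mk.injEq, Sigma.mk.injEq, heq_eq_eq, true_and] at h
        exact Subtype.ext h
      · rintro ⟨q, hq⟩
        obtain ⟨j', S', a', h, rfl, ha⟩ := id hq
        obtain ⟨hj, h⟩ := Sigma.mk.inj_iff.1 h
        obtain rfl : j = j' := by omega
        exact ⟨⟨a', (hch j S a').1 hq⟩, rfl⟩
  · rintro p q ⟨j, S, a, rfl, rfl, ha⟩; rfl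
  · rintro ⟨j, S⟩ ⟨j', S'⟩ hj hjj h
    simp only at hj hjj
    subst hjj
    cases j with
    | zero => simp at hj
    | succ j =>
      change Set (Nt j) at S
      change Set (Nt j) at S'
      congr 1
      apply h1 j
      intro a ha
      exact (hch j S' a).1 (h _ ((hch j S a).2 ha))

end ITX

namespace ITX
open Cardinal

structure QImm {V W : Type} (H : SimpleGraph V) (G : SimpleGraph W) where
  f : V → W
  inj : Function.Injective f
  walk : ∀ ⦃u v : V⦄, H.Adj u v → G.Walk (f u) (f v)
  disj : ∀ ⦃u v u' v' : V⦄ (h : H.Adj u v) (h' : H.Adj u' v'),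
    s(u, v) ≠ s(u', v') → ∀ e ∈ (walk h).edges, e ∉ (walk h').edges
  avoid : ∀ ⦃u v : V⦄ (h : H.Adj u v) (w : V), f w ∈ (walk h).support → w = u ∨ w = v

def QImm.ofImm {V W : Type} {H : SimpleGraph V} {G : SimpleGraph W} (φ : Immersion H G) : QImm H G where
  f := φ.toFun
  inj := φ.injective
  walk := φ.walk
  disj := φ.walk_edgeDisjoint
  avoid := fun u v h w hw => by
    by_contra hc
    push Not at hc
    exact φ.avoid h w hc.1 hc.2 hw

section comp
variable {U V W : Type} {H : SimpleGraph U} {G : SimpleGraph V} {K : SimpleGraph W}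

def bw (φ : QImm G K) : ∀ {a b : V}, G.Walk a b → K.Walk (φ.f a) (φ.f b)
  | _, _, .nil => .nil
  | _, _, .cons h w => (φ.walk h).append (bw φ w)

lemma bw_edges (φ : QImm G K) {a b : V} (w : G.Walk a b) (e) (he : e ∈ (bw φ w).edges) :
    ∃ u v, ∃ h : G.Adj u v, s(u, v) ∈ w.edges ∧ e ∈ (φ.walk h).edges := by
  induction w with
  | nil => simp [bw] at he
  | cons h w ih =>
    simp only [bw, Walk.edges_append, List.mem_append] at he
    rcases he with he | he
    · exact ⟨_, _, h, by simp, he⟩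
    · obtain ⟨u, v, h', h1, h2⟩ := ih he
      exact ⟨u, v, h', by simp [h1], h2⟩

lemma bw_support (φ : QImm G K) {a b : V} (w : G.Walk a b) (c) (he : φ.f c ∈ (bw φ w).support) :
    c ∈ w.support := by
  induction w with
  | nil =>
    simp only [bw, Walk.support_nil, List.mem_singleton] at he
    simp [φ.inj he]
  | cons h w ih =>
    simp only [bw, Walk.mem_support_append_iff] at he
    rcases he with he | he
    · rcases φ.avoid h c he with rfl | rfl <;> simp
    · simp [ih he]

def QImm.comp (φ : QImm G K) (α : QImm H G) : QImm H K where
  f := φ.f ∘ α.f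
  inj := φ.inj.comp α.inj
  walk := fun u v h => bw φ (α.walk h)
  disj := by
    intro u v u' v' h h' hne e he he'
    obtain ⟨a, b, hab, h1, h2⟩ := bw_edges φ _ e he
    obtain ⟨a', b', hab', h1', h2'⟩ := bw_edges φ _ e he'
    refine φ.disj hab hab' ?_ e h2 h2'
    intro h3
    rw [← h3] at h1'
    exact α.disj h h' hne _ h1 h1'
  avoid := by
    intro u v h w hw
    exact α.avoid h w (bw_support φ _ _ hw)
end comp

variable {V W : Type} {H : SimpleGraph V} {G : SimpleGraph W}

lemma first_step {a b : W} (w : G.Walk a b) (hab : a ≠ b) :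
    ∃ y, G.Adj a y ∧ s(a, y) ∈ w.edges ∧ y ∈ w.support := by
  cases w with
  | nil => exact absurd rfl hab
  | cons h w => exact ⟨_, h, by simp, by simp⟩

lemma QImm.deg (ψ : QImm H G) (u : V) : #(H.neighborSet u) ≤ #(G.neighborSet (ψ.f u)) := by
  have hne : ∀ v : H.neighborSet u, ψ.f u ≠ ψ.f v := fun v h => H.ne_of_adj v.2 (ψ.inj h)
  choose y h1 h2 h3 using fun v : H.neighborSet u => first_step (ψ.walk v.2) (hne v)
  refine Cardinal.mk_le_of_injective (f := fun v => ⟨y v, h1 v⟩) ?_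
  intro v v' h
  replace h : y v = y v' := congrArg Subtype.val h
  by_contra hvv
  have : s(u, v.1) ≠ s(u, v'.1) := by
    intro h4
    exact hvv (Subtype.ext (Sym2.congr_right.1 h4))
  exact ψ.disj v.2 v'.2 this _ (h2 v) (by rw [h]; exact h2 v')

lemma QImm.direct (ψ : QImm H G) {u v : V} (h : H.Adj u v)
    (hu : ∀ y, G.Adj (ψ.f u) y → ∃ w, ψ.f w = y) :
    s(ψ.f u, ψ.f v) ∈ (ψ.walk h).edges ∧ G.Adj (ψ.f u) (ψ.f v) := by
  obtain ⟨y, h1, h2, h3⟩ := first_step (ψ.walk h) (fun h' => H.ne_of_adj h (ψ.inj h'))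
  obtain ⟨w, rfl⟩ := hu y h1
  rcases ψ.avoid h w h3 with rfl | rfl
  · exact absurd rfl (G.ne_of_adj h1)
  · exact ⟨h2, h1⟩

end ITX

namespace ITX
open Cardinal

structure Dat extends Tower where
  X : Set (ℕ → Bool)
  e : List Bool → N → (ℕ → Bool)
  e_mem : ∀ s k, rank k = 0 → e s k ∈ X
  e_cyl : ∀ s k, rank k = 0 → e s k ∈ cyl s
  e_inj : ∀ s k k', rank k = 0 → rank k' = 0 → e s k = e s k' → k = k'
  rigid : ∀ f : (ℕ → Bool) → (ℕ → Bool), (∀ x ∈ X, f x ∈ X) → (∀ x ∈ X, ∀ y ∈ X, f x = f y → x = y) →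
      (∀ x ∈ X, ∀ y ∈ X, ∀ n, pre x n = pre y n → pre (f x) n = pre (f y) n) → ∀ x ∈ X, f x = x

theorem dat_exists : Nonempty Dat := by
  classical
  obtain ⟨T⟩ := tower_exists
  obtain ⟨X, h1, h2⟩ := dm
  obtain ⟨ε⟩ := Cardinal.eq.1 ((T.card_rank 0).trans T.κ_zero)
  choose g hg hg' using h1
  refine ⟨{ T with
    X := X
    e := fun s k => if h : T.rank k = 0 then g s (ε ⟨k, h⟩) else fun _ => false
    e_mem := ?_
    e_cyl := ?_
    e_inj := ?_
    rigid := h2 }⟩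
  · intro s k h; simp only [dif_pos h]; exact (hg' s _).1
  · intro s k h; simp only [dif_pos h]; exact (hg' s _).2
  · intro s k k' h h' he
    simp only [dif_pos h, dif_pos h'] at he
    have := ε.injective (hg s he)
    exact congrArg Subtype.val this

variable (D : Dat)

def Valid (s : List Bool) (p : D.N) (l : List D.N) : Prop :=
  1 ≤ D.rank p ∧ D.rank p + l.length = s.length + 2 ∧ List.IsChain (fun q p => D.child p q) (p :: l)

inductive Vx
  | pt (x : D.X) : Vx
  | tr (s : List Bool) (p : D.N) (l : List D.N) (h : Valid D s p l) : Vx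
  | ex (n : ℕ) : Vx

variable {D}
open Vx

def Rel (E : ℕ → Set D.X) : Vx D → Vx D → Prop
  | tr s p l _, pt x => (l = [] ∧ x.1 ∈ cyl s) ∨ (D.rank p = 1 ∧ ∃ k, D.child p k ∧ x.1 = D.e s k)
  | tr s _ l _, tr s' p l' _ => s = s' ∧ l = p :: l'
  | ex n, pt x => x ∈ E n
  | _, _ => False

def Gam (E : ℕ → Set D.X) : SimpleGraph (Vx D) where
  Adj u v := Rel E u v ∨ Rel E v u
  symm := ⟨fun u v h => h.symm⟩
  loopless := ⟨fun u h => by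
    cases u <;> simp [Rel] at h⟩

variable {E : ℕ → Set D.X}

lemma adj_tr_pt {s p l h x} : (Gam E).Adj (tr s p l h) (pt x) ↔
    (l = [] ∧ x.1 ∈ cyl s) ∨ (D.rank p = 1 ∧ ∃ k, D.child p k ∧ x.1 = D.e s k) := by
  simp [Gam, Rel]
lemma adj_tr_tr {s p l h s' p' l' h'} : (Gam E).Adj (tr s p l h) (tr s' p' l' h') ↔
    s = s' ∧ (l = p' :: l' ∨ l' = p :: l) := by
  simp only [Gam, Rel]
  constructor
  · rintro (⟨rfl, h1⟩ | ⟨rfl, h1⟩)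
    · exact ⟨rfl, Or.inl h1⟩
    · exact ⟨rfl, Or.inr h1⟩
  · rintro ⟨rfl, h | h⟩ <;> simp [h]
lemma adj_ex_pt {n x} : (Gam E).Adj (ex n) (pt x) ↔ x ∈ E n := by simp [Gam, Rel]
lemma adj_ex_tr {n s p l h} : ¬ (Gam E).Adj (ex n) (tr s p l h) := by simp [Gam, Rel]
lemma adj_ex_ex {n m} : ¬ (Gam E).Adj (ex n) (ex m) := by simp [Gam, Rel]
lemma adj_pt_pt {n m} : ¬ (Gam E).Adj (pt n) (pt m) := by simp [Gam, Rel]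

lemma adj_tr_pt_cyl {s p l h x} (ha : (Gam E).Adj (tr s p l h) (pt x)) : x.1 ∈ cyl s := by
  rw [adj_tr_pt] at ha
  rcases ha with ⟨_, h⟩ | ⟨h1, k, h2, h3⟩
  · exact h
  · rw [h3]; apply D.e_cyl
    have := D.child_rank _ _ h2; omega

lemma root_valid {s : List Bool} {p : D.N} (h : D.rank p = s.length + 2) : Valid D s p [] :=
  ⟨by omega, by simpa using h, by simp⟩

lemma child_valid {s : List Bool} {p q : D.N} {l} (h : Valid D s p l) (hc : D.child p q) (hq : 1 ≤ D.rank q) :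
    Valid D s q (p :: l) := by
  have := D.child_rank _ _ hc
  refine ⟨hq, ?_, ?_⟩
  · have := h.2.1; simp; omega
  · rw [List.isChain_cons_cons]; exact ⟨hc, h.2.2⟩

lemma par_valid {s : List Bool} {p q : D.N} {l} (h : Valid D s q (p :: l)) : Valid D s p l ∧ D.child p q := by
  obtain ⟨h1, h2, h3⟩ := h
  rw [List.isChain_cons_cons] at h3
  have := D.child_rank _ _ h3.1
  refine ⟨⟨by omega, ?_, h3.2⟩, h3.1⟩
  simp at h2; omega

lemma κ_inf (i : ℕ) : ℵ₀ ≤ D.κ i := by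
  calc ℵ₀ ≤ #(ℕ → Bool) := Cardinal.aleph0_le_mk _
    _ = D.κ 0 := D.κ_zero.symm
    _ ≤ D.κ i := D.κ_mono.monotone (Nat.zero_le i)

lemma card_X_le (i : ℕ) : #D.X ≤ D.κ i :=
  (Cardinal.mk_set_le _).trans (D.κ_zero.symm.le.trans (D.κ_mono.monotone (Nat.zero_le i)))

lemma card_range_pt (i : ℕ) : #(Set.range (pt : D.X → Vx D)) ≤ D.κ i :=
  Cardinal.mk_range_le.trans (card_X_le i)

lemma deg_ex_le (n : ℕ) : #((Gam E).neighborSet (ex n)) ≤ D.κ 0 := by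
  refine le_trans (Cardinal.mk_le_mk_of_subset ?_) (card_range_pt 0)
  intro y hy
  rw [mem_neighborSet] at hy
  cases y with
  | pt x => exact ⟨x, rfl⟩
  | tr s p l h => exact absurd hy adj_ex_tr
  | ex m => exact absurd hy adj_ex_ex

lemma deg_tr_le {s p l h} : #((Gam E).neighborSet (tr s p l h)) ≤ D.κ (D.rank p - 1) := by
  classical
  let lab : Vx D → D.N := fun y => match y with
    | tr _ q _ _ => q
    | _ => p
  let A : Set (Vx D) := {y | ∃ q h', y = tr s q (p :: l) h'}
  let B : Set (Vx D) := {y | ∃ q l' h', y = tr s q l' h' ∧ l = q :: l'}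
  have hsub : (Gam E).neighborSet (tr s p l h) ⊆ Set.range pt ∪ (A ∪ B) := by
    intro y hy
    rw [mem_neighborSet] at hy
    cases y with
    | pt x => exact Or.inl ⟨x, rfl⟩
    | tr s' q l' h' =>
      rw [adj_tr_tr] at hy
      obtain ⟨rfl, rfl | rfl⟩ := hy
      · exact Or.inr (Or.inr ⟨q, l', h', rfl, rfl⟩)
      · exact Or.inr (Or.inl ⟨q, h', rfl⟩)
    | ex m => exact absurd hy.symm adj_ex_tr
  have hA : #A ≤ D.κ (D.rank p - 1) := by
    rw [← D.card_child p h.1]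
    have hl : ∀ y : A, D.child p (lab y) := by
      rintro ⟨_, q, h', rfl⟩
      exact (par_valid h').2
    refine Cardinal.mk_le_of_injective (f := fun y => ⟨lab y, hl y⟩) ?_
    rintro ⟨_, q, h', rfl⟩ ⟨_, q', h'', rfl⟩ hq
    have : q = q' := congrArg Subtype.val hq
    subst this
    rfl
  have hB : #B ≤ D.κ (D.rank p - 1) := by
    have : B.Subsingleton := by
      rintro _ ⟨q, l', h', rfl, h1⟩ _ ⟨q', l'', h'', rfl, h2⟩
      rw [h1] at h2
      obtain ⟨rfl, rfl⟩ := List.cons.inj h2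
      rfl
    have h1 : #B ≤ 1 := Cardinal.mk_le_one_iff_set_subsingleton.2 this
    exact h1.trans (Cardinal.one_le_aleph0.trans (κ_inf _))
  refine (Cardinal.mk_le_mk_of_subset hsub).trans ((Cardinal.mk_union_le _ _).trans ?_)
  refine Cardinal.add_le_of_le (κ_inf _) (card_range_pt _) ?_
  exact (Cardinal.mk_union_le _ _).trans (Cardinal.add_le_of_le (κ_inf _) hA hB)

lemma deg_pt_ge (x : D.X) (n : ℕ) : D.κ (n + 2) ≤ #((Gam E).neighborSet (pt x)) := by
  rw [← D.card_rank (n+2)]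
  have hv : ∀ q : {q // D.rank q = n + 2}, Valid D (pre x.1 n) q.1 [] := fun q =>
    root_valid (by rw [pre_length]; exact q.2)
  refine Cardinal.mk_le_of_injective (f := fun q => ⟨tr (pre x.1 n) q.1 [] (hv q), ?_⟩) ?_
  · rw [mem_neighborSet, adj_comm, adj_tr_pt]; exact Or.inl ⟨rfl, mem_cyl_pre.2 rfl⟩
  · intro q q' h
    have := congrArg Subtype.val h
    simp only [Vx.tr.injEq] at this
    exact Subtype.ext this.2.1

lemma deg_tr_ge {s p l h} : D.κ (D.rank p - 1) ≤ #((Gam E).neighborSet (tr s p l h)) := by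
  rw [← D.card_child p h.1]
  by_cases h1 : D.rank p = 1
  · have h0 : ∀ q : {q // D.child p q}, D.rank q.1 = 0 := fun q => by
      have := D.child_rank _ _ q.2; omega
    refine Cardinal.mk_le_of_injective (f := fun q => ⟨pt ⟨D.e s q.1, D.e_mem s _ (h0 q)⟩, ?_⟩) ?_
    · rw [mem_neighborSet, adj_tr_pt]; exact Or.inr ⟨h1, q.1, q.2, rfl⟩
    · intro q q' h
      have := congrArg Subtype.val h
      simp only [Vx.pt.injEq, Subtype.mk.injEq] at this
      exact Subtype.ext (D.e_inj s _ _ (h0 q) (h0 q') this)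
  · have hp := h.1
    have h0 : ∀ q : {q // D.child p q}, 1 ≤ D.rank q.1 := fun q => by
      have := D.child_rank _ _ q.2; omega
    refine Cardinal.mk_le_of_injective (f := fun q => ⟨tr s q.1 (p :: l) (child_valid h q.2 (h0 q)), ?_⟩) ?_
    · rw [mem_neighborSet, adj_tr_tr]; exact ⟨rfl, Or.inr rfl⟩
    · intro q q' h
      have := congrArg Subtype.val h
      simp only [Vx.tr.injEq] at this
      exact Subtype.ext this.2.1

lemma chain_rank {l : List D.N} : ∀ {p : D.N}, List.IsChain (fun q p => D.child p q) (p :: l) →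
    ∀ a ∈ p :: l, D.rank a ≤ D.rank p + l.length := by
  induction l with
  | nil => intro p _ a ha; simp at ha; simp [ha]
  | cons b l ih =>
    intro p hp a ha
    rw [List.isChain_cons_cons] at hp
    have h1 := D.child_rank _ _ hp.1
    rcases List.mem_cons.1 ha with rfl | ha
    · omega
    · have := ih hp.2 a ha
      simp; omega

def Cs (D : Dat) (n : ℕ) : Set (Vx D) := fun y => match y with
  | tr s _ _ _ => s.length < n
  | _ => True

lemma card_low (m : ℕ) : #{q // D.rank q ≤ m} ≤ D.κ m := by
  have h1 : #{q // D.rank q ≤ m} ≤ #(Σ i : Fin (m+1), {q // D.rank q = i.1}) := by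
    refine Cardinal.mk_le_of_injective (f := fun q => ⟨⟨D.rank q.1, by have := q.2; omega⟩, ⟨q.1, rfl⟩⟩) ?_
    rintro ⟨q, hq⟩ ⟨q', hq'⟩ h
    simp only [Sigma.mk.injEq, Fin.mk.injEq] at h
    obtain ⟨h1, h2⟩ := h
    apply Subtype.ext
    show q = q'
    have := (Subtype.heq_iff_coe_eq (by intro x; simp [h1])).1 h2
    exact this
  refine h1.trans ?_
  rw [Cardinal.mk_sigma]
  refine (Cardinal.sum_le_sum _ (fun _ => D.κ m) (fun i => ?_)).trans ?_
  · rw [D.card_rank]; exact D.κ_mono.monotone (by omega)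
  · rw [Cardinal.sum_const']
    refine Cardinal.mul_le_of_le (κ_inf m) ?_ le_rfl
    exact (Cardinal.mk_lt_aleph0.le).trans (κ_inf m)

lemma card_Cs (n : ℕ) : #(Cs D n) ≤ D.κ (n + 1) := by
  classical
  have hr : ∀ s p l, Valid D s p l → s.length < n → ∀ a ∈ p :: l, D.rank a ≤ n + 1 := by
    intro s p l h hs a ha
    have := chain_rank h.2.2 a ha
    have := h.2.1
    omega
  let M := {q // D.rank q ≤ n + 1}
  let g : Cs D n → (D.X ⊕ ℕ) ⊕ (List Bool × List M) := fun y => match y with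
    | ⟨pt x, _⟩ => Sum.inl (Sum.inl x)
    | ⟨ex n, _⟩ => Sum.inl (Sum.inr n)
    | ⟨tr s p l h, h'⟩ => Sum.inr (s, (p :: l).attach.map (fun a => ⟨a.1, hr s p l h h' a.1 a.2⟩))
  have hg : Function.Injective g := by
    rintro ⟨y, hy⟩ ⟨y', hy'⟩ h
    cases y <;> cases y' <;> simp only [g, reduceCtorEq, Sum.inl.injEq, Sum.inr.injEq] at h
    · simp [h]
    · simp only [Prod.mk.injEq] at h
      obtain ⟨rfl, h⟩ := h
      have := congrArg (List.map Subtype.val) h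
      simp only [List.map_map, Function.comp_def] at this
      rw [List.attach_map_subtype_val, List.attach_map_subtype_val] at this
      obtain ⟨rfl, rfl⟩ := List.cons.inj this
      rfl
    · simp [h]
  refine (Cardinal.mk_le_of_injective hg).trans ?_
  have hM : #M ≤ D.κ (n+1) := card_low _
  have hM' : Infinite M := by
    rw [Cardinal.infinite_iff]
    refine (κ_inf (D := D) (n+1)).trans ?_
    rw [← D.card_rank (n+1)]
    exact Cardinal.mk_le_of_injective (f := fun q => (⟨q.1, q.2.le⟩ : M))
      (fun a b h => Subtype.ext (congrArg (Subtype.val : M → D.N) h))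
  simp only [Cardinal.mk_sum, Cardinal.mk_prod, Cardinal.lift_id, Cardinal.mk_list_eq_mk]
  refine Cardinal.add_le_of_le (κ_inf _) (Cardinal.add_le_of_le (κ_inf _) (card_X_le _) ?_) ?_
  · rw [Cardinal.mk_nat]; exact κ_inf _
  · refine Cardinal.mul_le_of_le (κ_inf _) ?_ hM
    exact Cardinal.mk_le_aleph0.trans (κ_inf _)

end ITX

namespace ITX
open Cardinal
open Vx
variable {D : Dat} {E E' : ℕ → Set D.X}

def col (n : ℕ) : Vx D → List Bool
  | pt x => pre x.1 n
  | tr r _ _ _ => r.take n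
  | ex _ => []

lemma cyl_take {x : ℕ → Bool} {s : List Bool} (h : x ∈ cyl s) {n} (hn : n ≤ s.length) :
    pre x n = s.take n := by
  have h' : pre x s.length = s := h
  rw [← pre_take x hn, h']

lemma col_adj' {n : ℕ} {s p l h} {v : Vx D} (ha : (Gam E).Adj (tr s p l h) v) :
    ((tr s p l h) ∈ Cs D n ∧ v ∈ Cs D n) ∨ col n (tr s p l h) = col n v := by
  cases v with
  | pt x =>
    have := adj_tr_pt_cyl ha
    by_cases hn : s.length < n
    · exact Or.inl ⟨hn, trivial⟩
    · right
      exact (cyl_take this (by omega)).symm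
  | tr s' p' l' h' =>
    rw [adj_tr_tr] at ha
    obtain ⟨rfl, _⟩ := ha
    exact Or.inr rfl
  | ex m => exact absurd ha.symm adj_ex_tr

lemma col_adj {n : ℕ} {u v : Vx D} (ha : (Gam E).Adj u v) :
    (u ∈ Cs D n ∧ v ∈ Cs D n) ∨ col n u = col n v := by
  cases u with
  | tr s p l h => exact col_adj' ha
  | pt x =>
    cases v with
    | tr s p l h =>
      rcases col_adj' (n := n) ha.symm with h | h
      · exact Or.inl h.symm
      · exact Or.inr h.symm
    | pt y => exact Or.inl ⟨trivial, trivial⟩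
    | ex m => exact Or.inl ⟨trivial, trivial⟩
  | ex m =>
    cases v with
    | tr s p l h => exact absurd ha adj_ex_tr
    | pt y => exact Or.inl ⟨trivial, trivial⟩
    | ex m => exact Or.inl ⟨trivial, trivial⟩

variable (ψ : QImm (Gam E) (Gam E'))

lemma psi_pt_pt (x : D.X) : ∃ y, ψ.f (pt x) = pt y := by
  have h1 := ψ.deg (pt x)
  generalize hw : ψ.f (pt x) = w at h1
  cases w with
  | pt y => exact ⟨y, rfl⟩
  | tr s p l h =>
    have h2 := (deg_pt_ge (E := E) x (D.rank p)).trans (h1.trans deg_tr_le)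
    exact absurd h2 (not_le.2 (D.κ_mono (by omega)))
  | ex n =>
    have h2 := (deg_pt_ge (E := E) x 0).trans (h1.trans (deg_ex_le n))
    exact absurd h2 (not_le.2 (D.κ_mono (by omega)))

lemma psi_lip (x y x' y' : D.X) (hx : ψ.f (pt x) = pt x') (hy : ψ.f (pt y) = pt y') (n : ℕ)
    (hxy : pre x.1 n = pre y.1 n) : pre x'.1 n = pre y'.1 n := by
  classical
  by_contra hne
  have hv : ∀ q : {q // D.rank q = n + 2}, Valid D (pre x.1 n) q.1 [] := fun q =>
    root_valid (by rw [pre_length]; exact q.2)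
  have a1 : ∀ q, (Gam E).Adj (pt x) (tr (pre x.1 n) q.1 [] (hv q)) := fun q => by
    rw [adj_comm, adj_tr_pt]; exact Or.inl ⟨rfl, mem_cyl_pre.2 rfl⟩
  have a2 : ∀ q, (Gam E).Adj (tr (pre x.1 n) q.1 [] (hv q)) (pt y) := fun q => by
    rw [adj_tr_pt]; exact Or.inl ⟨rfl, mem_cyl_pre.2 hxy.symm⟩
  have hd : ∀ q, ∃ d : (Gam E').Dart, d.edge ∈ ((ψ.walk (a1 q)).append (ψ.walk (a2 q))).edges ∧
      d.fst ∈ Cs D n ∧ d.snd ∈ Cs D n := by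
    intro q
    obtain ⟨d, h1, h2, h3⟩ := ((ψ.walk (a1 q)).append (ψ.walk (a2 q))).exists_boundary_dart
      {z | col n z = pre x'.1 n} (by show col n _ = _; rw [hx]; rfl)
      (by show ¬ (col n _ = _); rw [hy]; exact fun h => hne h.symm)
    refine ⟨d, List.mem_map_of_mem h1, ?_⟩
    rcases col_adj (n := n) d.adj with h | h
    · exact h
    · have h2' : col n d.fst = pre x'.1 n := h2
      exact absurd (show col n d.snd = pre x'.1 n by rw [← h, h2']) h3
  choose d h1 h2 h3 using hd
  have hinj : Function.Injective (fun q => ((⟨(d q).fst, h2 q⟩, ⟨(d q).snd, h3 q⟩) : Cs D n × Cs D n)) := by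
    intro q q' h
    simp only [Prod.mk.injEq, Subtype.mk.injEq] at h
    have he : (d q).edge = (d q').edge := by
      rw [show d q = d q' from SimpleGraph.Dart.ext _ _ (Prod.ext h.1 h.2)]
    by_contra hqq
    have hqq' : q.1 ≠ q'.1 := fun h => hqq (Subtype.ext h)
    have m1 := h1 q
    have m2 := h1 q'
    rw [← he] at m2
    simp only [Walk.edges_append, List.mem_append] at m1 m2
    rcases m1 with m1 | m1 <;> rcases m2 with m2 | m2 <;> refine ψ.disj _ _ ?_ _ m1 m2 <;>
      simp [hqq']
  have := Cardinal.mk_le_of_injective hinj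
  rw [D.card_rank, Cardinal.mk_prod, Cardinal.lift_id] at this
  refine absurd (this.trans (Cardinal.mul_le_of_le (κ_inf (n+1)) (card_Cs n) (card_Cs n))) (not_le.2 (D.κ_mono (by omega)))

theorem psi_pt (x : D.X) : ψ.f (pt x) = pt x := by
  classical
  choose g hg using psi_pt_pt ψ
  have := D.rigid (fun z => if h : z ∈ D.X then (g ⟨z, h⟩).1 else z) ?_ ?_ ?_ x.1 x.2
  · simp only [Subtype.coe_prop, dif_pos] at this
    rw [hg]; congr 1; exact Subtype.ext this
  · intro z hz; simp only [dif_pos hz]; exact (g _).2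
  · intro z hz z' hz' h
    simp only [dif_pos hz, dif_pos hz'] at h
    have h2 : ψ.f (pt ⟨z, hz⟩) = ψ.f (pt ⟨z', hz'⟩) := by rw [hg, hg]; congr 1; exact Subtype.ext h
    have := ψ.inj h2
    simpa using this
  · intro z hz z' hz' n h
    simp only [dif_pos hz, dif_pos hz']
    exact psi_lip ψ ⟨z, hz⟩ ⟨z', hz'⟩ _ _ (hg _) (hg _) n h

lemma pt_support {u v : Vx D} (h : (Gam E).Adj u v) {x : D.X} (hx : pt x ∈ (ψ.walk h).support) :
    pt x = u ∨ pt x = v := by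
  rw [← psi_pt ψ x] at hx
  exact ψ.avoid h _ hx

/-- non-points map to tree vertices of sufficient rank when of large degree -/
lemma psi_tr_cases {s p l h} : (∃ t p' l' h', ψ.f (tr s p l h) = tr t p' l' h' ∧ D.rank p ≤ D.rank p') ∨
    (D.rank p = 1 ∧ ∃ n, ψ.f (tr s p l h) = ex n) := by
  have h1 := ψ.deg (tr s p l h)
  generalize hw : ψ.f (tr s p l h) = w at h1
  cases w with
  | pt y =>
    rw [← psi_pt ψ y] at hw
    exact absurd (ψ.inj hw) (by simp)
  | tr t p' l' h' =>
    have h2 := D.κ_mono.le_iff_le.1 (deg_tr_ge.trans (h1.trans deg_tr_le))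
    have := h.1
    have := h'.1
    exact Or.inl ⟨t, p', l', h', rfl, by omega⟩
  | ex n =>
    have h2 := D.κ_mono.le_iff_le.1 (deg_tr_ge.trans (h1.trans (deg_ex_le n)))
    have := h.1
    exact Or.inr ⟨by omega, n, rfl⟩

lemma exists_X_cyl (s : List Bool) : ∃ x : D.X, x.1 ∈ cyl s := by
  have : #{q // D.rank q = 0} ≠ 0 := by
    rw [D.card_rank]; exact (Cardinal.aleph0_pos.trans_le (κ_inf 0)).ne'
  obtain ⟨k, hk⟩ := Cardinal.mk_ne_zero_iff.1 this
  exact ⟨⟨D.e s k, D.e_mem s k hk⟩, D.e_cyl s k hk⟩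

lemma psi_root {s p} (h : Valid D s p []) : ∃ p' h', ψ.f (tr s p [] h) = tr s p' [] h' := by
  have hr := h.2.1
  simp at hr
  rcases psi_tr_cases ψ (h := h) with ⟨t, p', l', h', hw, hp⟩ | ⟨h1, _⟩
  swap
  · omega
  have hcyl : ∀ x : D.X, x.1 ∈ cyl s → x.1 ∈ cyl t := by
    intro x hx
    have ha : (Gam E).Adj (tr s p [] h) (pt x) := adj_tr_pt.2 (Or.inl ⟨rfl, hx⟩)
    obtain ⟨d, h1, h2, h3⟩ := (ψ.walk ha).exists_boundary_dart
      {z | ∃ q m hq, z = tr t q m hq} (by rw [hw]; exact ⟨_, _, _, rfl⟩)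
      (by rw [psi_pt]; rintro ⟨q, m, hq, h⟩; simp at h)
    have had := d.adj
    obtain ⟨q, m, hq, h4⟩ := h2
    rw [h4] at had
    generalize hy : d.snd = y at had
    cases y with
    | pt z =>
      have hz := adj_tr_pt_cyl had
      have hs : pt z ∈ (ψ.walk ha).support := by rw [← hy]; exact Walk.dart_snd_mem_support_of_mem_darts _ h1
      rcases pt_support ψ ha hs with h5 | h5
      · simp at h5
      · simp at h5; rw [← h5]; exact hz
    | tr r q' m' hq' =>
      have := (adj_tr_tr.1 had).1
      subst this
      exact absurd ⟨q', m', hq', hy⟩ h3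
    | ex n => exact absurd had.symm adj_ex_tr
  have hlen := h'.2.1
  have hts : s.length = t.length := by
    by_contra hne
    have hlt : s.length < t.length := by omega
    obtain ⟨x, hx⟩ := exists_X_cyl (D := D) (s ++ [!(t[s.length])])
    have h1 : pre x.1 s.length = s := by
      have := cyl_take hx (n := s.length) (by simp)
      simpa using this
    have h2 : pre x.1 t.length = t := hcyl x h1
    have h3 : pre x.1 (s ++ [!(t[s.length])]).length = s ++ [!(t[s.length])] := hx
    have h4 : x.1 s.length = t[s.length] := by
      have : (pre x.1 t.length)[s.length]'(by rw [pre_length]; exact hlt) = x.1 s.length := by simp [pre]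
      rw [← this]; simp only [h2]
    have h5 : x.1 s.length = !(t[s.length]) := by
      have : (pre x.1 (s ++ [!(t[s.length])]).length)[s.length]'(by simp [pre_length]) = x.1 s.length := by simp [pre]
      rw [← this]; simp only [h3]; simp
    rw [h4] at h5
    simp at h5
  obtain ⟨x, hx⟩ := exists_X_cyl (D := D) s
  have e1 : pre x.1 s.length = s := hx
  have e2 : pre x.1 t.length = t := hcyl x hx
  have : s = t := by rw [← e1, ← e2, hts]
  subst this
  have : l' = [] := by
    apply List.length_eq_zero_iff.1; omega
  subst this
  exact ⟨p', h', hw⟩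

end ITX

namespace ITX
open Cardinal
open Vx
variable {D : Dat} {E E' : ℕ → Set D.X} (ψ : QImm (Gam E) (Gam E'))

/-- parents correspond -/
def Par (s : List Bool) (l l' : List D.N) : Prop :=
  l.length = l'.length ∧
    ((l = [] ∧ l' = []) ∨ ∃ a m a' m' h h', l = a :: m ∧ l' = a' :: m' ∧ ψ.f (tr s a m h) = tr s a' m' h')

lemma psi_child {s p l h p' l' h'} (hw : ψ.f (tr s p l h) = tr s p' l' h') (hpar : Par ψ s l l')
    {q} (hq : Valid D s q (p :: l)) : ∃ q' hq', ψ.f (tr s q (p :: l) hq) = tr s q' (p' :: l') hq' ∧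
      D.rank q' = D.rank q := by
  have ha : (Gam E).Adj (tr s p l h) (tr s q (p :: l) hq) := adj_tr_tr.2 ⟨rfl, Or.inr rfl⟩
  have hlen : l.length = l'.length := by
    exact hpar.1
  have hin : ∃ q' m hq', ψ.f (tr s q (p :: l) hq) = tr s q' m hq' ∧ (p' :: l') <:+ (q' :: m) := by
    by_contra hout
    obtain ⟨d, h1, h2, h3⟩ := (ψ.walk ha).exists_boundary_dart
      {z | ∃ q m hq, z = tr s q m hq ∧ (p' :: l') <:+ (q :: m)}
      (by rw [hw]; exact ⟨_, _, _, rfl, List.suffix_rfl⟩) hout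
    have had := d.adj
    obtain ⟨r, m, hr, h4, h5⟩ := h2
    rw [h4] at had
    have hsup := Walk.dart_snd_mem_support_of_mem_darts _ h1
    generalize hy : d.snd = y at had hsup
    cases y with
    | pt z => rcases pt_support ψ ha hsup with h5 | h5 <;> simp at h5
    | ex n => exact absurd had.symm adj_ex_tr
    | tr t r' m' hr' =>
      obtain ⟨rfl, h6 | h6⟩ := adj_tr_tr.1 had
      · -- going to the parent
        subst h6
        rcases List.suffix_cons_iff.1 h5 with h7 | h7
        · obtain ⟨rfl, rfl⟩ := List.cons.inj h7
          rcases hpar.2 with ⟨_, h8⟩ | ⟨a, n, a', n', k1, k2, rfl, k4, k5⟩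
          · simp at h8
          · obtain ⟨rfl, rfl⟩ := List.cons.inj k4
            rw [← k5] at hsup
            rcases ψ.avoid ha _ hsup with h9 | h9
            · simp at h9
            · simp only [Vx.tr.injEq] at h9
              have := congrArg List.length h9.2.2
              simp at this
              omega
        · exact h3 ⟨r', m', hr', hy, h7⟩
      · subst h6
        exact h3 ⟨r', _, hr', hy, h5.trans (List.suffix_cons _ _)⟩
  obtain ⟨q', m, hq', hwq, hsuf⟩ := hin
  rcases List.suffix_cons_iff.1 hsuf with h7 | h7
  · obtain ⟨rfl, rfl⟩ := List.cons.inj h7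
    have := ψ.inj (hw.trans hwq.symm)
    simp only [Vx.tr.injEq] at this
    have := congrArg List.length this.2.2
    simp at this
  · have hd := ψ.deg (tr s q (p :: l) hq)
    rw [hwq] at hd
    have h8 := D.κ_mono.le_iff_le.1 (deg_tr_ge.trans (hd.trans deg_tr_le))
    have h9 := h7.length_le
    have e1 := hq.2.1
    have e2 := hq'.2.1
    have e3 := hq.1
    have e4 := hq'.1
    simp at h9 e1
    have : m = p' :: l' := (h7.eq_of_length (by simp; omega)).symm
    subst this
    refine ⟨q', hq', hwq, ?_⟩
    simp at e2
    omega


lemma psi_claim {s : List Bool} (i : ℕ) : ∀ {p l h p' l' h'}, D.rank p = i + 1 →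
    ψ.f (tr s p l h) = tr s p' l' h' → Par ψ s l l' → p = p' := by
  induction i with
  | zero =>
    intro p l h p' l' h' hi hw hpar
    have e1 := h.2.1
    have e2 := h'.2.1
    have e3 := hpar.1
    apply D.antichain p p' h.1 (by omega)
    intro k hk
    have hk0 : D.rank k = 0 := by have := D.child_rank _ _ hk; omega
    have ha : (Gam E).Adj (tr s p l h) (pt ⟨D.e s k, D.e_mem s k hk0⟩) :=
      adj_tr_pt.2 (Or.inr ⟨hi, k, hk, rfl⟩)
    have := (ψ.direct ha ?_).2
    · rw [hw, psi_pt, adj_tr_pt] at this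
      rcases this with ⟨h1, _⟩ | ⟨_, k', hk', he⟩
      · subst h1; simp only [List.length_nil] at e2 e3; omega
      · have hk0' : D.rank k' = 0 := by have := D.child_rank _ _ hk'; omega
        rw [D.e_inj s k k' hk0 hk0' he]; exact hk'
    · intro y hy
      rw [hw] at hy
      cases y with
      | pt x => exact ⟨_, psi_pt ψ x⟩
      | ex n => exact absurd hy.symm adj_ex_tr
      | tr t q m hq =>
        obtain ⟨rfl, h6 | h6⟩ := adj_tr_tr.1 hy
        · subst h6
          rcases hpar.2 with ⟨_, h8⟩ | ⟨a, n, a', n', k1, k2, rfl, k4, k5⟩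
          · simp at h8
          · obtain ⟨rfl, rfl⟩ := List.cons.inj k4
            exact ⟨_, k5⟩
        · subst h6
          have := D.child_rank _ _ (par_valid hq).2
          have := hq.1
          omega
  | succ i ih =>
    intro p l h p' l' h' hi hw hpar
    have e1 := h.2.1
    have e2 := h'.2.1
    have e3 := hpar.1
    apply D.antichain p p' h.1 (by omega)
    intro q hq
    have hqr := D.child_rank _ _ hq
    obtain ⟨q', hq', hwq, hr⟩ := psi_child ψ hw hpar (child_valid h hq (by omega))
    have : q = q' := ih (by omega) hwq ⟨by simp [e3], Or.inr ⟨p, l, p', l', h, h', rfl, rfl, hw⟩⟩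
    rw [this]
    exact (par_valid hq').2

lemma psi_tr_aux {s : List Bool} {l} : ∀ {p h}, ψ.f (tr s p l h) = tr s p l h ∧ Par ψ s l l := by
  induction l with
  | nil =>
    intro p h
    obtain ⟨p', h', hw⟩ := psi_root ψ h
    have hp : Par ψ s [] [] := ⟨rfl, Or.inl ⟨rfl, rfl⟩⟩
    have : p = p' := psi_claim ψ (D.rank p - 1) (by have := h.1; omega) hw hp
    subst this
    exact ⟨hw, hp⟩
  | cons a l ih =>
    intro p h
    have hv := (par_valid h).1
    obtain ⟨ih1, ih2⟩ := ih (h := hv)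
    obtain ⟨p', h', hw, _⟩ := psi_child ψ ih1 ih2 h
    have hp : Par ψ s (a :: l) (a :: l) := ⟨rfl, Or.inr ⟨a, l, a, l, hv, hv, rfl, rfl, ih1⟩⟩
    have : p = p' := psi_claim ψ (D.rank p - 1) (by have := h.1; omega) hw hp
    subst this
    exact ⟨hw, hp⟩

theorem psi_tr {s p l h} : ψ.f (tr s p l h) = tr s p l h := (psi_tr_aux ψ).1

theorem psi_ex (n : ℕ) : ∃ m, ψ.f (ex n) = ex m := by
  generalize hw : ψ.f (ex n) = w
  cases w with
  | pt y =>
    rw [← psi_pt ψ y] at hw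
    exact absurd (ψ.inj hw) (by simp)
  | tr t p' l' h' =>
    rw [← psi_tr ψ (h := h')] at hw
    exact absurd (ψ.inj hw) (by simp)
  | ex m => exact ⟨m, rfl⟩

/-- all edges are mapped through the direct edge -/
theorem psi_edge {u v : Vx D} (h : (Gam E).Adj u v) :
    ∃ u' v', ∃ h' : (Gam E).Adj u' v', s(u', v') = s(u, v) ∧
      s(ψ.f u', ψ.f v') ∈ (ψ.walk h').edges ∧ (Gam E').Adj (ψ.f u') (ψ.f v') := by
  have key : ∀ {u v : Vx D} (h : (Gam E).Adj u v), (∀ x, u ≠ pt x) →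
      s(ψ.f u, ψ.f v) ∈ (ψ.walk h).edges ∧ (Gam E').Adj (ψ.f u) (ψ.f v) := by
    intro u v h hu
    apply ψ.direct h
    intro y hy
    cases y with
    | pt x => exact ⟨_, psi_pt ψ x⟩
    | tr t p' l' h' => exact ⟨_, psi_tr ψ⟩
    | ex m =>
      cases u with
      | pt x => exact absurd rfl (hu x)
      | tr t p' l' h' => rw [psi_tr] at hy; exact absurd hy.symm adj_ex_tr
      | ex n =>
        obtain ⟨k, hk⟩ := psi_ex ψ n
        rw [hk] at hy
        exact absurd hy adj_ex_ex
  by_cases hu : ∀ x, u ≠ pt x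
  · exact ⟨u, v, h, rfl, key h hu⟩
  · have hv : ∀ x, v ≠ pt x := by
      rintro x rfl
      push Not at hu
      obtain ⟨y, rfl⟩ := hu
      exact adj_pt_pt h
    exact ⟨v, u, h.symm, Sym2.eq_swap, key h.symm hv⟩

theorem psi_E {n m : ℕ} (h : ψ.f (ex n) = ex m) : E n ⊆ E' m := by
  intro x hx
  obtain ⟨u, v, ha, h1, h2, h3⟩ := psi_edge ψ (adj_ex_pt.2 hx)
  have : (Gam E').Adj (ψ.f (ex n)) (ψ.f (pt x)) := by
    rcases Sym2.eq_iff.1 h1 with ⟨rfl, rfl⟩ | ⟨rfl, rfl⟩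
    · exact h3
    · exact h3.symm
  rw [h, psi_pt] at this
  exact adj_ex_pt.1 this

end ITX

namespace ITX
open Cardinal
open Vx
variable {D : Dat} {E E' : ℕ → Set D.X}

lemma gam_hom (τ : ℕ → ℕ) (hτ : Function.Injective τ) (hE : ∀ n, E n ⊆ E' (τ n)) :
    ∃ f : Gam E →g Gam E', Function.Injective f := by
  let f : Vx D → Vx D := fun v => match v with
    | ex n => ex (τ n)
    | pt x => pt x
    | tr s p l h => tr s p l h
  have hR : ∀ u v, Rel E u v → Rel E' (f u) (f v) := by
    intro u v h
    cases u <;> cases v <;> simp only [Rel, f] at h ⊢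
    · exact h
    · exact h
    · exact hE _ h
  refine ⟨⟨f, ?_⟩, ?_⟩
  · intro u v h
    exact h.imp (hR _ _) (hR _ _)
  · intro u v h
    change f u = f v at h
    cases u <;> cases v <;> simp only [f, reduceCtorEq] at h
    · exact h
    · exact h
    · rw [hτ (Vx.ex.inj h)]

lemma gam_conn (hE : ∀ n, (E n).Nonempty) : (Gam E).Connected := by
  have : #{q // D.rank q = 2} ≠ 0 := by
    rw [D.card_rank]; exact (Cardinal.aleph0_pos.trans_le (κ_inf 2)).ne'
  obtain ⟨p0, hp0⟩ := Cardinal.mk_ne_zero_iff.1 this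
  have h0 : Valid D [] p0 [] := root_valid (by simpa using hp0)
  have hpt : ∀ x, (Gam E).Reachable (pt x) (tr [] p0 [] h0) := fun x => by
    have : (Gam E).Adj (tr [] p0 [] h0) (pt x) := adj_tr_pt.2 (Or.inl ⟨rfl, by simp [cyl, pre]⟩)
    exact this.symm.reachable
  have hall : ∀ v, (Gam E).Reachable v (tr [] p0 [] h0) := by
    intro v
    cases v with
    | pt x => exact hpt x
    | ex n =>
      obtain ⟨x, hx⟩ := hE n
      exact (adj_ex_pt.2 hx).reachable.trans (hpt x)
    | tr s p l h =>
      induction l generalizing p with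
      | nil =>
        obtain ⟨x, hx⟩ := exists_X_cyl (D := D) s
        exact ((adj_tr_pt (E := E) (h := h)).2 (Or.inl ⟨rfl, hx⟩)).reachable.trans (hpt x)
      | cons a l ih =>
        have ha : (Gam E).Adj (tr s p (a :: l) h) (tr s a l (par_valid h).1) :=
          adj_tr_tr.2 ⟨rfl, Or.inl rfl⟩
        exact ha.reachable.trans (ih _ _)
  haveI : Nonempty (Vx D) := ⟨ex 0⟩
  exact ⟨fun u v => (hall u).trans (hall v).symm⟩

lemma X_inf : Infinite D.X := by
  rw [Cardinal.infinite_iff]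
  refine (κ_inf (D := D) 0).trans ?_
  rw [← D.card_rank 0]
  refine Cardinal.mk_le_of_injective (f := fun q => (⟨D.e [] q.1, D.e_mem _ _ q.2⟩ : D.X)) ?_
  intro q q' h
  exact Subtype.ext (D.e_inj [] _ _ q.2 q'.2 (congrArg Subtype.val h))

lemma ab_exists : ∃ a b : ℕ → D.X, Function.Injective a ∧ Function.Injective b ∧ ∀ i j, a i ≠ b j := by
  haveI := X_inf (D := D)
  let c := Infinite.natEmbedding D.X
  refine ⟨fun n => c (2*n), fun n => c (2*n+1), ?_, ?_, ?_⟩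
  · intro n m h; have := c.injective h; omega
  · intro n m h; have := c.injective h; omega
  · intro n m h; have := c.injective h; omega

/-- edge covering via a composition -/
lemma cover {W : Type} {G' : SimpleGraph W} (φ : QImm G' (Gam E')) (α : QImm (Gam E) G') {u v : Vx D}
    (h : (Gam E).Adj u v) : ∃ u' v', ∃ h' : G'.Adj u' v',
      s((φ.comp α).f u, (φ.comp α).f v) ∈ (φ.walk h').edges := by
  obtain ⟨u1, v1, h1, h2, h3, _⟩ := psi_edge (φ.comp α) h
  obtain ⟨a, b, hab, _, h4⟩ := bw_edges φ _ _ h3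
  refine ⟨a, b, hab, ?_⟩
  have : s((φ.comp α).f u, (φ.comp α).f v) = s((φ.comp α).f u1, (φ.comp α).f v1) := by
    rcases Sym2.eq_iff.1 h2 with ⟨rfl, rfl⟩ | ⟨rfl, rfl⟩
    · rfl
    · exact Sym2.eq_swap
  rw [this]; exact h4

lemma main4 {a b : ℕ → D.X} (ha : Function.Injective a) (hb : Function.Injective b)
    (hab : ∀ i j, a i ≠ b j) (π : Equiv.Perm ℕ) {W : Type} {G' : SimpleGraph W}
    (φ : QImm G' (Gam (fun n => {a n, b (π n)})))
    (α : QImm (Gam (fun n => {a n})) G') (β : QImm (Gam (fun n => {b n})) G') :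
    Function.Bijective φ.f ∧ ∀ u v, G'.Adj u v ↔ (Gam (fun n => {a n, b (π n)})).Adj (φ.f u) (φ.f v) := by
  have exA : ∀ n, (φ.comp α).f (ex n) = ex n := by
    intro n
    obtain ⟨m, hm⟩ := psi_ex (φ.comp α) n
    have := psi_E _ hm (show a n ∈ ({a n} : Set D.X) from rfl)
    rcases this with h | h
    · rw [hm, ha h]
    · exact absurd h (hab _ _)
  have exB : ∀ n, (φ.comp β).f (ex (π n)) = ex n := by
    intro n
    obtain ⟨m, hm⟩ := psi_ex (φ.comp β) (π n)
    have := psi_E _ hm (show b (π n) ∈ ({b (π n)} : Set D.X) from rfl)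
    rcases this with h | h
    · exact absurd h.symm (hab _ _)
    · rw [hm, π.injective (hb h)]
  have hsurj : Function.Surjective φ.f := by
    intro y
    cases y with
    | pt x => exact ⟨_, psi_pt (φ.comp α) x⟩
    | tr s p l h => exact ⟨_, psi_tr (φ.comp α)⟩
    | ex n => exact ⟨_, exA n⟩
  have hcov : ∀ u v, (Gam (fun n => {a n, b (π n)})).Adj u v → ∃ u' v', ∃ h' : G'.Adj u' v',
      s(u, v) ∈ (φ.walk h').edges := by
    have key : ∀ u v, Rel (fun n => {a n, b (π n)}) u v → ∃ u' v', ∃ h' : G'.Adj u' v',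
      s(u, v) ∈ (φ.walk h').edges := by
      intro u v h
      cases u with
      | pt x => cases v <;> simp [Rel] at h
      | tr s p l hv =>
        cases v with
        | pt x =>
          have h' : (Gam (fun n => {a n})).Adj (tr s p l hv) (pt x) := Or.inl h
          have := cover φ α h'
          rwa [psi_pt, psi_tr] at this
        | tr s' p' l' hv' =>
          have h' : (Gam (fun n => {a n})).Adj (tr s p l hv) (tr s' p' l' hv') := Or.inl h
          have := cover φ α h'
          rwa [psi_tr, psi_tr] at this
        | ex m => simp [Rel] at h
      | ex n =>
        cases v with
        | pt x =>
          rcases h with h | h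
          · have h' : (Gam (fun n => {a n})).Adj (ex n) (pt x) := Or.inl h
            have := cover φ α h'
            rwa [psi_pt, exA] at this
          · have h' : (Gam (fun n => {b n})).Adj (ex (π n)) (pt x) := Or.inl h
            have := cover φ β h'
            rwa [psi_pt, exB] at this
        | tr s' p' l' hv' => simp [Rel] at h
        | ex m => simp [Rel] at h
    intro u v h
    rcases h with h | h
    · exact key u v h
    · rw [Sym2.eq_swap]; exact key v u h
  refine ⟨⟨φ.inj, hsurj⟩, fun u v => ⟨fun h => (φ.direct h (fun y _ => hsurj y)).2, fun h => ?_⟩⟩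
  obtain ⟨u', v', h', he⟩ := hcov _ _ h
  have h1 := φ.avoid h' u (Walk.fst_mem_support_of_mem_edges _ he)
  have h2 := φ.avoid h' v (Walk.snd_mem_support_of_mem_edges _ he)
  have hne : u ≠ v := fun hh => (Gam _).ne_of_adj h (by rw [hh])
  rcases h1 with rfl | rfl <;> rcases h2 with rfl | rfl
  · exact absurd rfl hne
  · exact h'
  · exact h'.symm
  · exact absurd rfl hne

end ITX

/-- There exist infinite graphs `G₁`, `G₂` and an infinite family `𝓕` of infinite graphs
such that: (IT1) `𝓕` is an immersion antichain; (IT2) every member of `𝓕` is connected;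
(IT3) both `G₁` and `G₂` are (isomorphic to) subgraphs of each member of `𝓕`; and
(IT4) no graph properly immersed in a member of `𝓕` admits immersions of both `G₁`
and `G₂`. -/
theorem exists_intertwine_antichain :
    ∃ (V₁ V₂ : Type) (G₁ : SimpleGraph V₁) (G₂ : SimpleGraph V₂)
      (ι : Type) (Vf : ι → Type) (F : ∀ i : ι, SimpleGraph (Vf i)),
      Infinite V₁ ∧ Infinite V₂ ∧ Infinite ι ∧ (∀ i : ι, Infinite (Vf i)) ∧
      (∀ i j : ι, i ≠ j → ¬ Immersed (F i) (F j)) ∧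
      (∀ i : ι, (F i).Connected) ∧
      (∀ i : ι, (∃ f : G₁ →g F i, Function.Injective f) ∧
        (∃ f : G₂ →g F i, Function.Injective f)) ∧
      (∀ i : ι, ∀ (W : Type) (G' : SimpleGraph W),
        ProperlyImmersed G' (F i) → ¬ Immersed G₁ G' ∨ ¬ Immersed G₂ G') := by
  classical
  obtain ⟨D⟩ := ITX.dat_exists
  obtain ⟨a, b, ha, hb, hab⟩ := ITX.ab_exists (D := D)
  have hinf : Infinite (ITX.Vx D) :=
    Infinite.of_injective ITX.Vx.ex (fun _ _ h => ITX.Vx.ex.inj h)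
  refine ⟨ITX.Vx D, ITX.Vx D, ITX.Gam (fun n => {a n}), ITX.Gam (fun n => {b n}),
    Equiv.Perm ℕ, fun _ => ITX.Vx D, fun π => ITX.Gam (fun n => {a n, b (π n)}),
    hinf, hinf, ?_, fun _ => hinf, ?_, ?_, ?_, ?_⟩
  · refine Infinite.of_injective (fun n : ℕ => Equiv.swap 0 n) ?_
    intro n m h
    have := congrArg (fun e : Equiv.Perm ℕ => e 0) h
    simpa using this
  · rintro π σ hne ⟨φ⟩
    apply hne
    ext n
    obtain ⟨m, hm⟩ := ITX.psi_ex (ITX.QImm.ofImm φ) n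
    have hsub := ITX.psi_E _ hm
    have h1 := hsub (show a n ∈ ({a n, b (π n)} : Set D.X) from Or.inl rfl)
    have h2 := hsub (show b (π n) ∈ ({a n, b (π n)} : Set D.X) from Or.inr rfl)
    have hnm : n = m := by
      rcases h1 with h | h
      · exact ha h
      · exact absurd h (hab _ _)
    subst hnm
    rcases h2 with h | h
    · exact absurd h.symm (hab _ _)
    · exact hb h
  · intro π
    exact ITX.gam_conn (fun n => ⟨a n, Or.inl rfl⟩)
  · intro π
    refine ⟨ITX.gam_hom id Function.injective_id ?_, ITX.gam_hom π.symm π.symm.injective ?_⟩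
    · rintro n x rfl
      exact Or.inl rfl
    · rintro n x rfl
      right
      simp
  · rintro π W G' ⟨φ, hφ⟩
    by_contra hcon
    push Not at hcon
    obtain ⟨⟨α⟩, ⟨β⟩⟩ := hcon
    exact hφ (ITX.main4 ha hb hab π (ITX.QImm.ofImm φ) (ITX.QImm.ofImm α) (ITX.QImm.ofImm β))
end

section
/- The class of infinite graphs quasi-ordered by the immersion relation does not satisfy the finite intertwine property: there exist infinite graphs G₁ and G₂ such that the class of immersion intertwines of G₁ and G₂ contains an infinite antichain with respect to the immersion relation. -/
open SimpleGraph

namespace Intertwine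

open Cardinal

/-- Points: infinite binary sequences. -/
abbrev X := ℕ → Bool

/-- Agreement of the first `n` bits. -/
def E (n : ℕ) (x y : X) : Prop := ∀ k < n, x k = y k

/-- A rapidly growing sequence of sets. -/
def M : ℕ → Type
  | 0 => X
  | n + 1 => Set (M n)

theorem mk_M_lt (n : ℕ) : #(M n) < #(M (n + 1)) := by
  change #(M n) < #(Set (M n))
  rw [Cardinal.mk_set]
  exact Cardinal.cantor _

theorem mk_M_mono {m n : ℕ} (h : m ≤ n) : #(M m) ≤ #(M n) :=
  monotone_nat_of_le_succ (f := fun n => #(M n)) (fun n => (mk_M_lt n).le) h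

theorem mk_X_le (n : ℕ) : #X ≤ #(M n) := mk_M_mono (Nat.zero_le n)

theorem mk_X : #X = 𝔠 := by
  simp [X]

theorem aleph0_le_X : ℵ₀ ≤ #X := by
  rw [mk_X]; exact aleph0_le_continuum

theorem aleph0_le_M (n : ℕ) : ℵ₀ ≤ #(M n) := aleph0_le_X.trans (mk_X_le n)

/-- Diagonalization. -/
theorem diag {I : Type} (hI : #I ≤ #X) (f : I → X → X) (hf : ∀ i, Function.Injective (f i))
    (hm : ∀ i, #X ≤ #{x | f i x ≠ x}) :
    ∃ x : I → X, Function.Injective x ∧ ∀ i j, f i (x i) ≠ x j := by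
  classical
  obtain ⟨r, wo, hr⟩ := Cardinal.exists_ord_eq I
  have key : ∀ (i : I) (g : ∀ j, r j i → X), ∃ x : X, f i x ≠ x ∧
      ∀ j (h : r j i), x ≠ g j h ∧ x ≠ f j (g j h) ∧ f i x ≠ g j h := by
    intro i g
    have hlt : #{j // r j i} < #X := by
      refine lt_of_lt_of_le ?_ hI
      have := Cardinal.card_typein_lt i hr
      exact this
    let B : Set X := (Set.range fun j : {j // r j i} => g j.1 j.2) ∪
      ((Set.range fun j : {j // r j i} => f j.1 (g j.1 j.2)) ∪
       (f i ⁻¹' (Set.range fun j : {j // r j i} => g j.1 j.2)))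
    have h1 : #(Set.range fun j : {j // r j i} => g j.1 j.2) < #X := mk_range_le.trans_lt hlt
    have h2 : #(Set.range fun j : {j // r j i} => f j.1 (g j.1 j.2)) < #X :=
      mk_range_le.trans_lt hlt
    have h3 : #(f i ⁻¹' (Set.range fun j : {j // r j i} => g j.1 j.2)) < #X :=
      (mk_preimage_of_injective _ _ (hf i)).trans_lt h1
    have hB : #B < #X := by
      refine (mk_union_le _ _).trans_lt (add_lt_of_lt aleph0_le_X h1 ?_)
      exact (mk_union_le _ _).trans_lt (add_lt_of_lt aleph0_le_X h2 h3)
    have : ¬ {x | f i x ≠ x} ⊆ B := fun h =>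
      absurd ((hm i).trans (mk_le_mk_of_subset h)) (not_le.2 hB)
    obtain ⟨x, hx, hxB⟩ := Set.not_subset.1 this
    refine ⟨x, hx, fun j h => ⟨?_, ?_, ?_⟩⟩
    · intro he; exact hxB (Or.inl ⟨⟨j, h⟩, he.symm⟩)
    · intro he; exact hxB (Or.inr (Or.inl ⟨⟨j, h⟩, he.symm⟩))
    · intro he; exact hxB (Or.inr (Or.inr ⟨⟨j, h⟩, he.symm⟩))
  choose c hc1 hc2 using key
  let x : I → X := wo.wf.fix c
  have hx : ∀ i, x i = c i (fun j _ => x j) := fun i => wo.wf.fix_eq c i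
  have p1 : ∀ i, f i (x i) ≠ x i := by
    intro i; rw [hx i]; exact hc1 _ _
  have p2 : ∀ i j, r j i → x i ≠ x j ∧ x i ≠ f j (x j) ∧ f i (x i) ≠ x j := by
    intro i j h
    have := hc2 i (fun j _ => x j) j h
    rw [← hx i] at this
    exact this
  refine ⟨x, ?_, ?_⟩
  · intro i j hij
    rcases trichotomous_of r i j with h | h | h
    · exact absurd hij.symm (p2 j i h).1
    · exact h
    · exact absurd hij (p2 i j h).1
  · intro i j
    rcases trichotomous_of r i j with h | h | h
    · exact (p2 j i h).2.1.symm
    · subst h; exact p1 i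
    · exact (p2 i j h).2.2

/-- Nonidentity injective maps preserving all `E n`. -/
def Good : Type :=
  {f : X → X // Function.Injective f ∧ (∀ n x y, E n x y → E n (f x) (f y)) ∧ f ≠ id}

theorem mk_Good : #Good ≤ #X := by
  classical
  let T : Good → (Finset ℕ → X) := fun f s => f.1 (fun k => decide (k ∈ s))
  have hT : Function.Injective T := by
    rintro ⟨f, hf0, hf, hf1⟩ ⟨g, hg0, hg, hg1⟩ h
    apply Subtype.ext
    funext x n
    have h' := congrFun (congrFun h ((Finset.range (n + 1)).filter (fun k => x k = true))) n
    have hE : E (n + 1) x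
        (fun k => decide (k ∈ (Finset.range (n + 1)).filter (fun k => x k = true))) := by
      intro k hk
      cases hxk : x k <;> simp [hxk, hk]
    have a := hf _ _ _ hE n (Nat.lt_succ_self n)
    have b := hg _ _ _ hE n (Nat.lt_succ_self n)
    exact a.trans (h'.trans b.symm)
  refine (mk_le_of_injective hT).trans ?_
  rw [← power_def, mk_X]
  simp

theorem mk_moved (f : Good) : #X ≤ #{x | f.1 x ≠ x} := by
  obtain ⟨f, hi, hE, hne⟩ := f
  obtain ⟨p, hp⟩ := Function.ne_iff.1 hne
  obtain ⟨k, hk⟩ := Function.ne_iff.1 hp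
  let z : X → X := fun z n => if n ≤ k then p n else z (n - (k + 1))
  have hz : ∀ y, E (k + 1) (z y) p := by
    intro y n hn
    have : n ≤ k := by omega
    simp [z, this]
  have hz2 : ∀ y, f (z y) ≠ z y := by
    intro y h
    have a := hE _ _ _ (hz y) k (Nat.lt_succ_self k)
    have b := hz y k (Nat.lt_succ_self k)
    rw [h] at a
    exact hk (a.symm.trans b)
  refine mk_le_of_injective (f := fun y => (⟨z y, hz2 y⟩ : {x | f x ≠ x})) ?_
  intro y y' h
  have h' : z y = z y' := congrArg Subtype.val h
  funext n
  have := congrFun h' (n + (k + 1))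
  have hn : ¬ (n + (k + 1) ≤ k) := by omega
  simpa [z, hn] using this

/-- Flip the `n`th bit. -/
def flip (n : ℕ) : Good := by
  refine ⟨fun x k => if k = n then !(x k) else x k, ?_, ?_, ?_⟩
  · intro x y h
    funext k
    have := congrFun h k
    by_cases hk : k = n <;> simpa [hk] using this
  · intro m x y h k hk
    have := h k hk
    by_cases hk : k = n <;> simp_all
  · intro h
    have := congrFun (congrFun h (fun _ => true)) n
    simp at this

theorem flip_injective : Function.Injective flip := by
  intro m n h
  have h1 := congrArg Subtype.val h
  have h2 := congrFun (congrFun h1 (fun _ => true)) m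
  by_contra hne
  simp [flip, hne] at h2

theorem exists_D : ∃ D : Set X, D.Infinite ∧ ∀ f : X → X, Function.Injective f →
    (∀ n x y, E n x y → E n (f x) (f y)) → (∀ x ∈ D, f x ∈ D) → f = id := by
  obtain ⟨x, hx, hd⟩ := diag mk_Good (fun f => f.1) (fun f => f.2.1) mk_moved
  refine ⟨Set.range x, ?_, ?_⟩
  · have : Infinite Good := Infinite.of_injective _ flip_injective
    exact Set.infinite_range_of_injective hx
  · intro f hi hE hD
    by_contra hne
    obtain ⟨j, hj⟩ := hD (x ⟨f, hi, hE, hne⟩) ⟨_, rfl⟩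
    exact hd ⟨f, hi, hE, hne⟩ j hj.symm

/-! Weak immersions -/

structure WImm {V W : Type} (H : SimpleGraph V) (G : SimpleGraph W) where
  f : V → W
  inj : Function.Injective f
  walk : ∀ ⦃u v : V⦄, H.Adj u v → G.Walk (f u) (f v)
  disj : ∀ ⦃u v u' v' : V⦄ (h : H.Adj u v) (h' : H.Adj u' v'),
    s(u, v) ≠ s(u', v') → ∀ e ∈ (walk h).edges, e ∉ (walk h').edges

def ofImm {V W : Type} {H : SimpleGraph V} {G : SimpleGraph W} (φ : Immersion H G) :
    WImm H G := ⟨φ.toFun, φ.injective, φ.walk, φ.walk_edgeDisjoint⟩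

/-- Image of a walk under an immersion. -/
def mapWalk {V W : Type} {H : SimpleGraph V} {G : SimpleGraph W} (φ : WImm H G) :
    ∀ {u v : V}, H.Walk u v → G.Walk (φ.f u) (φ.f v)
  | _, _, .nil => .nil
  | _, _, .cons h p => (φ.walk h).append (mapWalk φ p)

theorem mem_mapWalk {V W : Type} {H : SimpleGraph V} {G : SimpleGraph W} (φ : WImm H G)
    {u v : V} (p : H.Walk u v) {e : Sym2 W} (he : e ∈ (mapWalk φ p).edges) :
    ∃ (a b : V) (h : H.Adj a b), s(a, b) ∈ p.edges ∧ e ∈ (φ.walk h).edges := by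
  induction p with
  | nil => simp [mapWalk] at he
  | cons h p ih =>
    rw [mapWalk, SimpleGraph.Walk.edges_append, List.mem_append] at he
    rcases he with he | he
    · exact ⟨_, _, h, by simp, he⟩
    · obtain ⟨a, b, h', h1, h2⟩ := ih he
      exact ⟨a, b, h', by simp [h1], h2⟩

def WImm.comp {U V W : Type} {K : SimpleGraph U} {H : SimpleGraph V} {G : SimpleGraph W}
    (φ : WImm H G) (ψ : WImm K H) : WImm K G where
  f := φ.f ∘ ψ.f
  inj := φ.inj.comp ψ.inj
  walk _ _ h := mapWalk φ (ψ.walk h)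
  disj := by
    intro u v u' v' h h' hne e he he'
    obtain ⟨a, b, h1, h2, h3⟩ := mem_mapWalk φ _ he
    obtain ⟨a', b', h1', h2', h3'⟩ := mem_mapWalk φ _ he'
    by_cases hs : s(a, b) = s(a', b')
    · rw [← hs] at h2'
      exact ψ.disj h h' hne _ h2 h2'
    · exact φ.disj h1 h1' hs _ h3 h3'

theorem WImm.degree_le {V W : Type} {H : SimpleGraph V} {G : SimpleGraph W}
    (φ : WImm H G) (u : V) : #(H.neighborSet u) ≤ #(G.neighborSet (φ.f u)) := by
  have key : ∀ v : H.neighborSet u, ∃ w : G.neighborSet (φ.f u),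
      s(φ.f u, w.1) ∈ (φ.walk v.2).edges := by
    rintro ⟨v, hv⟩
    have hne : φ.f u ≠ φ.f v := fun h => hv.ne (φ.inj h)
    obtain ⟨w, h, q, hq⟩ := SimpleGraph.Walk.exists_eq_cons_of_ne hne (φ.walk hv)
    exact ⟨⟨w, h⟩, by simp [hq]⟩
  choose g hg using key
  refine mk_le_of_injective (f := g) ?_
  intro v v' h
  by_contra hne
  have h1 := hg v
  have h2 := hg v'
  rw [← h] at h2
  refine φ.disj v.2 v'.2 ?_ _ h1 h2
  intro he
  apply hne
  apply Subtype.ext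
  rcases Sym2.eq_iff.1 he with h | h
  · exact h.2
  · exact h.2.trans h.1

/-- An injective homomorphism is an immersion. -/
theorem immersed_of_hom {V W : Type} {H : SimpleGraph V} {G : SimpleGraph W} (f : V → W)
    (hf : Function.Injective f) (hadj : ∀ ⦃u v⦄, H.Adj u v → G.Adj (f u) (f v)) :
    Immersed H G := by
  refine ⟨⟨f, hf, fun u v h => (hadj h).toWalk, ?_, ?_, ?_, ?_, ?_⟩⟩
  · intro u v h
    simpa using (hadj h).ne
  · intro u v h; simp
  · intro u v h; simp
  · intro u v u' v' h h' hne e he he'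
    simp at he he'
    rw [he] at he'
    apply hne
    have := he'
    rw [← Sym2.map_mk, ← Sym2.map_mk] at this
    exact Sym2.map.injective hf this
  · intro u v h w h1 h2
    simp [hf.eq_iff, h1, h2]

/-! The graphs -/

/-- Connecting vertices. -/
abbrev W := Σ n : ℕ, X × M n

theorem aleph0_le_W : ℵ₀ ≤ #W := by
  refine (aleph0_le_M 0).trans ?_
  refine mk_le_of_injective (f := fun m => (⟨0, fun _ => true, m⟩ : W)) ?_
  intro a b h
  simpa using h

/-- Vertices of the first graph. -/
abbrev V1 (D : Set X) := X ⊕ (W ⊕ (D × Set W))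

/-- The first graph. -/
def G1 (D : Set X) : SimpleGraph (V1 D) where
  Adj
    | .inl x, .inr (.inl w) => E w.1 x w.2.1
    | .inr (.inl w), .inl x => E w.1 x w.2.1
    | .inl x, .inr (.inr p) => p.1.1 = x
    | .inr (.inr p), .inl x => p.1.1 = x
    | .inl _, .inl _ => False
    | .inr _, .inr _ => False
  symm := ⟨by
    rintro (u | u | u) (v | v | v) h <;> exact h⟩
  loopless := ⟨by
    rintro (u | u | u) h <;> exact h⟩

/-- Add pendant leaves at `j`. -/
def addStar {V : Type} (G : SimpleGraph V) (j : V) (L : Type) : SimpleGraph (V ⊕ L) where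
  Adj
    | .inl u, .inl v => G.Adj u v
    | .inl u, .inr _ => u = j
    | .inr _, .inl v => v = j
    | .inr _, .inr _ => False
  symm := ⟨by
    rintro (u | u) (v | v) h
    · exact SimpleGraph.Adj.symm h
    · exact h
    · exact h
    · exact h⟩
  loopless := ⟨by
    rintro (u | u) h
    · exact G.loopless.irrefl _ h
    · exact h⟩

theorem mk_neighbor_le {V : Type} (G : SimpleGraph V) (j : V) (L : Type) [Infinite V]
    (v : V ⊕ L) (hv : v ≠ .inl j) : #((addStar G j L).neighborSet v) ≤ #V := by
  have : (addStar G j L).neighborSet v ⊆ Set.range Sum.inl := by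
    rintro (w | w) hw
    · exact ⟨w, rfl⟩
    · rcases v with v | v
      · exact absurd (congrArg Sum.inl hw) hv
      · exact hw.elim
  exact (mk_le_mk_of_subset this).trans mk_range_le

theorem le_mk_neighbor {V : Type} (G : SimpleGraph V) (j : V) (L : Type) :
    #L ≤ #((addStar G j L).neighborSet (.inl j)) := by
  refine mk_le_of_injective
    (f := fun l => (⟨.inr l, rfl⟩ : (addStar G j L).neighborSet (.inl j))) ?_
  intro a b h
  exact Sum.inr_injective (congrArg Subtype.val h)

theorem immersed_addStar {V : Type} (G : SimpleGraph V) (j : V) (L : Type) :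
    Immersed G (addStar G j L) :=
  immersed_of_hom Sum.inl Sum.inl_injective (fun _ _ h => h)

theorem star_immersed {V : Type} (G : SimpleGraph V) (j : V) (L : Type) :
    Immersed (addStar (⊥ : SimpleGraph Unit) () L) (addStar G j L) := by
  refine immersed_of_hom (Sum.map (fun _ => j) id) ?_ ?_
  · rintro (a | a) (b | b) h <;> simp_all
  · rintro (a | a) (b | b) h
    · exact h.elim
    · rfl
    · rfl
    · exact h.elim

/-- Rebuilding the graph with a star from an immersion and a vertex of big degree. -/
theorem addStar_immersed {V U : Type} [Infinite V] (G : SimpleGraph V) (j : V) (L : Type)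
    (hL : #V < #L) (G' : SimpleGraph U) (ψ : Immersion G G')
    (hdeg : #L ≤ #(G'.neighborSet (ψ.toFun j))) : Immersed (addStar G j L) G' := by
  classical
  let S : V × V → Set U := fun p => {w | ∃ h : G.Adj p.1 p.2, w ∈ (ψ.walk h).support}
  let Bad : Set U := (⋃ p, S p) ∪ Set.range ψ.toFun
  have hV : ℵ₀ ≤ #V := Cardinal.aleph0_le_mk V
  have hS : ∀ p, #(S p) ≤ ℵ₀ := by
    intro p
    rw [Cardinal.le_aleph0_iff_set_countable]
    by_cases h : G.Adj p.1 p.2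
    · refine (List.finite_toSet (ψ.walk h).support).countable.mono ?_
      rintro w ⟨h', hw⟩
      exact hw
    · refine Set.countable_empty.mono ?_
      rintro w ⟨h', hw⟩
      exact h h'
  have hBad : #Bad ≤ #V := by
    refine (mk_union_le _ _).trans (add_le_of_le hV ?_ mk_range_le)
    refine (mk_iUnion_le_sum_mk).trans ((Cardinal.sum_le_sum _ (fun _ => ℵ₀) hS).trans ?_)
    rw [Cardinal.sum_const', mk_prod, lift_id, mul_eq_self hV, mul_eq_left hV hV aleph0_ne_zero]
  have hN : #L ≤ #(G'.neighborSet (ψ.toFun j) \ Bad : Set U) := by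
    by_contra hlt
    rw [not_le] at hlt
    have h1 : G'.neighborSet (ψ.toFun j) ⊆ (G'.neighborSet (ψ.toFun j) \ Bad) ∪ Bad := by
      intro x hx
      by_cases hb : x ∈ Bad
      · exact Or.inr hb
      · exact Or.inl ⟨hx, hb⟩
    have h2 := (hdeg.trans (mk_le_mk_of_subset h1)).trans (mk_union_le _ _)
    exact absurd h2 (not_le.2 (add_lt_of_lt (hV.trans hL.le) hlt (hBad.trans_lt hL)))
  obtain ⟨g⟩ := hN
  have gadj : ∀ l, G'.Adj (ψ.toFun j) (g l).1 := fun l => (g l).2.1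
  have gbad : ∀ l, (g l).1 ∉ Bad := fun l => (g l).2.2
  have gr : ∀ l v, ψ.toFun v ≠ (g l).1 := fun l v h => gbad l (Or.inr ⟨v, h⟩)
  have gs : ∀ l u v (h : G.Adj u v), (g l).1 ∉ (ψ.walk h).support := fun l u v h hw =>
    gbad l (Or.inl (Set.mem_iUnion.2 ⟨(u, v), h, hw⟩))
  have ginj : ∀ l l', (g l).1 = (g l').1 → l = l' := fun l l' h => g.injective (Subtype.ext h)
  have gadj' : ∀ l u, u = j → G'.Adj (ψ.toFun u) (g l).1 := by
    rintro l u rfl; exact gadj l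
  let F : V ⊕ L → U := Sum.elim ψ.toFun (fun l => (g l).1)
  let wk : ∀ (u v : V ⊕ L), (addStar G j L).Adj u v → G'.Walk (F u) (F v) := fun u v =>
    match u, v with
    | .inl u, .inl v => fun h => ψ.walk (show G.Adj u v from h)
    | .inl u, .inr l => fun h => (gadj' l u h).toWalk
    | .inr l, .inl v => fun h => (gadj' l v h).symm.toWalk
    | .inr _, .inr _ => fun h => h.elim
  have tp : ∀ {a b : U} (h : G'.Adj a b), h.toWalk.IsPath := fun h => by simpa using h.ne
  have tl : ∀ {a b : U} (h : G'.Adj a b), 0 < h.toWalk.length := fun h => by simp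
  have tr : ∀ {a b : U} (h : G'.Adj a b), h.symm.toWalk = h.toWalk.reverse := fun h => by simp
  refine ⟨⟨F, ?_, fun u v h => wk u v h, ?_, ?_, ?_, ?_, ?_⟩⟩
  · rintro (u | u) (v | v) h
    · exact congrArg _ (ψ.injective h)
    · exact absurd h (gr _ _)
    · exact absurd h.symm (gr _ _)
    · exact congrArg _ (ginj _ _ h)
  · rintro (u | u) (v | v) h
    · exact ψ.walk_isPath _
    · exact tp _
    · exact tp _
    · exact h.elim
  · rintro (u | u) (v | v) h
    · exact ψ.walk_nontrivial _
    · exact tl _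
    · exact tl _
    · exact h.elim
  · rintro (u | u) (v | v) h
    · exact ψ.walk_symm _
    · exact tr (gadj' v u h)
    · exact tr (gadj' u v h).symm
    · exact h.elim
  · have a1 : ∀ (u v : V) (h : G.Adj u v) l x, s(x, (g l).1) ∉ (ψ.walk h).edges :=
      fun u v h l x he => gs l u v h (SimpleGraph.Walk.snd_mem_support_of_mem_edges _ he)
    have e1 : ∀ (u : V) (l : L) (h : (addStar G j L).Adj (.inl u) (.inr l)),
        (wk _ _ h).edges = [s(ψ.toFun j, (g l).1)] := by
      intro u l h
      have : u = j := h
      subst this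
      simp [wk, F]
    have e2 : ∀ (u : V) (l : L) (h : (addStar G j L).Adj (.inr l) (.inl u)),
        (wk _ _ h).edges = [s(ψ.toFun j, (g l).1)] := by
      intro u l h
      have : u = j := h
      subst this
      simp [wk, F, Sym2.eq_swap]
    have e3 : ∀ l l', s(ψ.toFun j, (g l).1) = s(ψ.toFun j, (g l').1) → l = l' := by
      intro l l' h
      rcases Sym2.eq_iff.1 h with h | h
      · exact ginj _ _ h.2
      · exact absurd h.1 (gr _ _)
    rintro (u | u) (v | v) (u' | u') (v' | v') h h' hne e he he' <;>
      first
      | exact h.elim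
      | exact h'.elim
      | skip
    · refine ψ.walk_edgeDisjoint (show G.Adj u v from h) (show G.Adj u' v' from h') ?_ e he he'
      intro hs
      exact hne (congrArg (Sym2.map Sum.inl) hs)
    · rw [e1 u' v' h', List.mem_singleton] at he'
      subst he'
      exact a1 _ _ _ _ _ he
    · rw [e2 v' u' h', List.mem_singleton] at he'
      subst he'
      exact a1 _ _ _ _ _ he
    · rw [e1 u v h, List.mem_singleton] at he
      subst he
      exact a1 _ _ _ _ _ he'
    · rw [e1 u v h, List.mem_singleton] at he
      rw [e1 u' v' h', List.mem_singleton] at he'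
      have h1 : u = j := h
      have h2 : u' = j := h'
      exact hne (by rw [e3 _ _ (he.symm.trans he'), h1, h2])
    · rw [e1 u v h, List.mem_singleton] at he
      rw [e2 v' u' h', List.mem_singleton] at he'
      have h1 : u = j := h
      have h2 : v' = j := h'
      exact hne (by rw [e3 _ _ (he.symm.trans he'), h1, h2, Sym2.eq_swap])
    · rw [e2 v u h, List.mem_singleton] at he
      subst he
      exact a1 _ _ _ _ _ he'
    · rw [e2 v u h, List.mem_singleton] at he
      rw [e1 u' v' h', List.mem_singleton] at he'
      have h1 : v = j := h
      have h2 : u' = j := h'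
      exact hne (by rw [e3 _ _ (he.symm.trans he'), h1, h2, Sym2.eq_swap])
    · rw [e2 v u h, List.mem_singleton] at he
      rw [e2 v' u' h', List.mem_singleton] at he'
      have h1 : v = j := h
      have h2 : v' = j := h'
      exact hne (by rw [e3 _ _ (he.symm.trans he'), h1, h2])
  · rintro (u | u) (v | v) h (w | w) h1 h2
    · exact ψ.avoid (show G.Adj u v from h) w (fun e => h1 (congrArg _ e))
        (fun e => h2 (congrArg _ e))
    · exact gs _ _ _ _
    · have : w ≠ u := fun e => h1 (congrArg _ e)
      simp [wk, F, ψ.injective.eq_iff, this, gr]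
    · have : w ≠ v := fun e => h2 (congrArg _ e)
      simp only [wk, F, Sum.elim_inl, Sum.elim_inr, SimpleGraph.Walk.support_cons,
        SimpleGraph.Walk.support_nil, SimpleGraph.Adj.toWalk, List.mem_cons, List.not_mem_nil, or_false, not_or]
      exact ⟨(gr _ _).symm, fun e => this (ginj _ _ e)⟩
    · have : w ≠ v := fun e => h2 (congrArg _ e)
      simp [wk, F, ψ.injective.eq_iff, this, gr]
    · have : w ≠ u := fun e => h1 (congrArg _ e)
      simp only [wk, F, Sum.elim_inl, Sum.elim_inr, SimpleGraph.Walk.support_cons,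
        SimpleGraph.Walk.support_nil, SimpleGraph.Adj.toWalk, List.mem_cons, List.not_mem_nil, or_false, not_or]
      exact ⟨fun e => this (ginj _ _ e), (gr _ _).symm⟩
    · exact h.elim
    · exact h.elim

/-- The antichain members. -/
abbrev Gj (D : Set X) (j : X) : SimpleGraph (V1 D ⊕ Set (V1 D)) :=
  addStar (G1 D) (.inl j) (Set (V1 D))

theorem adj_XW (D : Set X) (x : X) (w : W) (h : E w.1 x w.2.1) :
    (G1 D).Adj (.inl x) (.inr (.inl w)) := by
  exact h

theorem adj_XL (D : Set X) (x : D) (l : Set W) :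
    (G1 D).Adj (.inl x.1) (.inr (.inr (x, l))) := by
  exact rfl

/-- Edges between points and low connecting vertices. -/
def Cut (D : Set X) (n : ℕ) : Set (Sym2 (V1 D ⊕ Set (V1 D))) :=
  {e | ∃ (z : X) (w : W), w.1 ≤ n ∧ e = s(.inl (.inl z), .inl (.inr (.inl w)))}

theorem mk_Cut (D : Set X) (n : ℕ) : #(Cut D n) ≤ #(M n) := by
  let T : X × (Σ k : Fin (n + 1), X × M k) → Sym2 (V1 D ⊕ Set (V1 D)) :=
    fun p => s(.inl (.inl p.1), .inl (.inr (.inl ⟨p.2.1, p.2.2⟩)))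
  have h1 : Cut D n ⊆ Set.range T := by
    rintro e ⟨z, ⟨k, w⟩, hk, rfl⟩
    exact ⟨(z, ⟨⟨k, Nat.lt_succ_of_le hk⟩, w⟩), rfl⟩
  refine (mk_le_mk_of_subset h1).trans (mk_range_le.trans ?_)
  have hM := aleph0_le_M n
  rw [mk_prod, lift_id, lift_id]
  refine mul_le_of_le hM (mk_X_le n) ?_
  rw [mk_sigma]
  refine (Cardinal.sum_le_sum _ (fun _ => #(M n)) ?_).trans ?_
  · intro k
    rw [mk_prod, lift_id, lift_id]
    exact mul_le_of_le hM (mk_X_le n) (mk_M_mono (Nat.le_of_lt_succ k.2))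
  · rw [Cardinal.sum_const']
    refine mul_le_of_le hM ?_ le_rfl
    exact (Cardinal.mk_le_aleph0).trans hM

/-- The side of the cut. -/
def Side (D : Set X) (j : X) (n : ℕ) (x : X) : V1 D ⊕ Set (V1 D) → Prop
  | .inl (.inl z) => E n x z
  | .inl (.inr (.inl w)) => n ≤ w.1 ∧ E n x w.2.1
  | .inl (.inr (.inr p)) => E n x p.1.1
  | .inr _ => E n x j

theorem E.mono {m n : ℕ} {x y : X} (h : E n x y) (hmn : m ≤ n) : E m x y :=
  fun k hk => h k (hk.trans_le hmn)

theorem E.symm {n : ℕ} {x y : X} (h : E n x y) : E n y x := fun k hk => (h k hk).symm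

theorem E.trans {n : ℕ} {x y z : X} (h : E n x y) (h' : E n y z) : E n x z :=
  fun k hk => (h k hk).trans (h' k hk)

theorem side_or_cut (D : Set X) (j : X) (n : ℕ) (x : X) {a b : V1 D ⊕ Set (V1 D)}
    (h : (Gj D j).Adj a b) : (Side D j (n + 1) x a ↔ Side D j (n + 1) x b) ∨ s(a, b) ∈ Cut D n := by
  have key : ∀ z w, E w.1 z w.2.1 →
      (Side D j (n + 1) x (.inl (.inl z)) ↔ Side D j (n + 1) x (.inl (.inr (.inl w)))) ∨
        s((.inl (.inl z) : V1 D ⊕ Set (V1 D)), .inl (.inr (.inl w))) ∈ Cut D n := by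
    intro z w hE
    by_cases hw : w.1 ≤ n
    · exact Or.inr ⟨z, w, hw, rfl⟩
    · have hE' : E (n + 1) z w.2.1 := hE.mono (by omega)
      refine Or.inl ⟨fun h => ⟨by omega, E.trans h hE'⟩, fun h => E.trans h.2 hE'.symm⟩
  rcases a with (z | w | p) | l <;> rcases b with (z' | w' | p') | l'
  case inl.inl.inl.inr.inl =>
    apply key
    exact h
  case inl.inr.inl.inl.inl =>
    rw [Sym2.eq_swap, Iff.comm]
    apply key
    exact h
  all_goals first
    | exact False.elim h
    | exact nomatch (show Sum.inr _ = Sum.inl _ from h)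
    | (left; cases (show Sum.inl _ = Sum.inl _ from h); exact Iff.rfl)
    | (left; cases (show Subtype.val _ = _ from h); exact Iff.rfl)

theorem preserves (D : Set X) (j : X) (φ : WImm (G1 D) (Gj D j)) {x y x' y' : X}
    (hx : φ.f (.inl x) = .inl (.inl x')) (hy : φ.f (.inl y) = .inl (.inl y'))
    (n : ℕ) (h : E n x y) : E n x' y' := by
  rcases n with _ | n
  · intro k hk; omega
  by_contra hne
  have key : ∀ m : M (n + 1), ∃ e ∈ Cut D n,
      (e ∈ (φ.walk (adj_XW D x ⟨n + 1, x, m⟩ (fun _ _ => rfl))).edges ∨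
       e ∈ (φ.walk (adj_XW D y ⟨n + 1, x, m⟩ h.symm).symm).edges) := by
    intro m
    let p := (φ.walk (adj_XW D x ⟨n + 1, x, m⟩ (fun _ _ => rfl))).append
      (φ.walk (adj_XW D y ⟨n + 1, x, m⟩ h.symm).symm)
    obtain ⟨d, hd, h1, h2⟩ := p.exists_boundary_dart {v | Side D j (n + 1) x' v}
      (by rw [hx]; exact fun _ _ => rfl) (by rw [hy]; exact hne)
    refine ⟨d.edge, ?_, ?_⟩
    · rcases side_or_cut D j n x' d.adj with h | h
      · exact absurd (h.1 h1) h2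
      · exact h
    · have : d.edge ∈ p.edges := List.mem_map_of_mem hd
      simpa [p] using this
  choose e he1 he2 using key
  have hinj : Function.Injective (fun m => (⟨e m, he1 m⟩ : Cut D n)) := by
    intro m m' hm
    have hm' : e m = e m' := congrArg Subtype.val hm
    by_contra hmm
    have a := he2 m
    have b := he2 m'
    rw [← hm'] at b
    rcases a with a | a <;> rcases b with b | b <;>
      exact φ.disj _ _ (by simp [hmm]) _ a b
  exact absurd ((mk_le_of_injective hinj).trans (mk_Cut D n)) (not_le.2 (mk_M_lt n))

theorem point_to_point (D : Set X) (j : X) (φ : WImm (G1 D) (Gj D j)) (x : X) :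
    ∃ x', φ.f (.inl x) = .inl (.inl x') := by
  have h1 : #(M 1) ≤ #((G1 D).neighborSet (.inl x)) := by
    refine mk_le_of_injective (f := fun m => (⟨.inr (.inl ⟨1, x, m⟩),
      adj_XW D x ⟨1, x, m⟩ (fun _ _ => rfl)⟩ : (G1 D).neighborSet (.inl x))) ?_
    intro a b h
    have h' := congrArg Subtype.val h
    simpa using h'
  have h2 := h1.trans (φ.degree_le _)
  have h3 : #X < #(M 1) := mk_M_lt 0
  by_contra hne
  have h4 : (Gj D j).neighborSet (φ.f (.inl x)) ⊆ Set.range (fun z => .inl (.inl z)) := by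
    intro v hv
    rcases hu : φ.f (.inl x) with (z | w | p) | l
    · exact absurd ⟨z, hu⟩ hne
    all_goals
      rw [hu] at hv
      rcases v with (z' | w' | p') | l'
      · exact ⟨z', rfl⟩
      all_goals first
        | exact False.elim hv
        | exact nomatch (show _ = _ from hv)
  exact absurd (h2.trans ((mk_le_mk_of_subset h4).trans mk_range_le)) (not_le.2 h3)

theorem D_to_D (D : Set X) (j : X) (hj : j ∈ D) (φ : WImm (G1 D) (Gj D j)) {x x' : X}
    (hx : φ.f (.inl x) = .inl (.inl x')) (hxD : x ∈ D) : x' ∈ D := by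
  have h1 : #(Set W) ≤ #((G1 D).neighborSet (.inl x)) := by
    refine mk_le_of_injective (f := fun l => (⟨.inr (.inr (⟨x, hxD⟩, l)),
      adj_XL D ⟨x, hxD⟩ l⟩ : (G1 D).neighborSet (.inl x))) ?_
    intro a b h
    have h' := congrArg Subtype.val h
    simpa using h'
  have h2 := h1.trans (φ.degree_le _)
  rw [hx] at h2
  by_contra hne
  have h4 : (Gj D j).neighborSet (.inl (.inl x')) ⊆ Set.range (fun w => .inl (.inr (.inl w))) := by
    intro v hv
    rcases v with (z' | w' | p') | l'
    · exact False.elim hv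
    · exact ⟨w', rfl⟩
    · have hv' : p'.1.1 = x' := hv
      exact absurd (hv' ▸ p'.1.2) hne
    · have hv' : (Sum.inl x' : V1 D) = Sum.inl j := hv
      exact absurd (Sum.inl_injective hv' ▸ hj) hne
  have h3 := h2.trans ((mk_le_mk_of_subset h4).trans mk_range_le)
  rw [mk_set] at h3
  exact absurd h3 (not_le.2 (cantor _))

theorem fixes (D : Set X) (hD : ∀ f : X → X, Function.Injective f →
    (∀ n x y, E n x y → E n (f x) (f y)) → (∀ x ∈ D, f x ∈ D) → f = id)
    (j : X) (hj : j ∈ D) (φ : WImm (G1 D) (Gj D j)) (x : X) :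
    φ.f (.inl x) = .inl (.inl x) := by
  choose f hf using point_to_point D j φ
  have : f = id := by
    apply hD
    · intro a b h
      have : φ.f (.inl a) = φ.f (.inl b) := by rw [hf, hf, h]
      exact Sum.inl_injective (φ.inj this)
    · intro n a b h
      exact preserves D j φ (hf a) (hf b) n h
    · intro a ha
      exact D_to_D D j hj φ (hf a) ha
  rw [hf, this]; rfl

end Intertwine

open Intertwine Cardinal in
/-- The class of infinite graphs quasi-ordered by immersion does not satisfy the finite
intertwine property: there are infinite graphs `G₁` and `G₂` whose class of immersion
intertwines contains an infinite immersion antichain. -/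
theorem not_finite_intertwine_property :
    ∃ (V₁ V₂ : Type) (G₁ : SimpleGraph V₁) (G₂ : SimpleGraph V₂),
      Infinite V₁ ∧ Infinite V₂ ∧
      ∃ (ι : Type) (Vf : ι → Type) (F : ∀ i : ι, SimpleGraph (Vf i)),
        Infinite ι ∧ (∀ i : ι, Infinite (Vf i)) ∧
        (∀ i : ι, Immersed G₁ (F i) ∧ Immersed G₂ (F i) ∧
          ∀ (W : Type) (G' : SimpleGraph W), Infinite W →
            Immersed G' (F i) → ¬ Immersed (F i) G' →
            (¬ Immersed G₁ G' ∨ ¬ Immersed G₂ G')) ∧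
        (∀ i j : ι, i ≠ j → ¬ Immersed (F i) (F j)) := by
  obtain ⟨D, hDinf, hD⟩ := exists_D
  have hlt : #(V1 D) < #(Set (V1 D)) := by
    rw [mk_set]; exact cantor _
  have : Infinite X := Cardinal.infinite_iff.2 aleph0_le_X
  refine ⟨V1 D, Unit ⊕ Set (V1 D), G1 D, addStar ⊥ () (Set (V1 D)), inferInstance, inferInstance,
    D, fun _ => V1 D ⊕ Set (V1 D), fun j => Gj D j.1, hDinf.to_subtype, fun _ => inferInstance,
    ?_, ?_⟩
  · intro j
    refine ⟨immersed_addStar _ _ _, star_immersed _ _ _, ?_⟩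
    rintro U G' - ⟨χ⟩ hno
    by_contra hcon
    push Not at hcon
    obtain ⟨⟨ψ⟩, ⟨σ⟩⟩ := hcon
    apply hno
    apply addStar_immersed _ _ _ hlt _ ψ
    have h1 : χ.toFun (ψ.toFun (.inl j.1)) = .inl (.inl j.1) :=
      fixes D hD j.1 j.2 ((ofImm χ).comp (ofImm ψ)) j.1
    have h2 : #(Set (V1 D)) ≤ #(G'.neighborSet (σ.toFun (.inl ()))) :=
      (le_mk_neighbor _ _ _).trans ((ofImm σ).degree_le _)
    have h3 : χ.toFun (σ.toFun (.inl ())) = .inl (.inl j.1) := by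
      by_contra hne
      exact absurd ((h2.trans ((ofImm χ).degree_le _)).trans (mk_neighbor_le _ _ _ _ hne))
        (not_le.2 hlt)
    rw [χ.injective (h1.trans h3.symm)]
    exact h2
  · rintro i j hij ⟨φ⟩
    obtain ⟨inc⟩ := immersed_addStar (G1 D) (.inl i.1) (Set (V1 D))
    let ρ : WImm (G1 D) (Gj D j.1) :=
      ⟨fun v => φ.toFun (.inl v), φ.injective.comp Sum.inl_injective,
        fun u v h => φ.walk (show (Gj D i.1).Adj (.inl u) (.inl v) from h),
        fun u v u' v' h h' hne => φ.walk_edgeDisjoint _ _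
          (fun he => hne (Sym2.map.injective Sum.inl_injective he))⟩
    have h1 : φ.toFun (.inl (.inl i.1)) = .inl (.inl i.1) := fixes D hD j.1 j.2 ρ i.1
    have h2 := (le_mk_neighbor (G1 D) (.inl i.1) (Set (V1 D))).trans ((ofImm φ).degree_le _)
    have h3 : (ofImm φ).f (.inl (.inl i.1)) ≠ .inl (.inl j.1) := by
      intro h
      have h4 := h1.symm.trans h
      exact hij (Subtype.ext (Sum.inl_injective (Sum.inl_injective h4)))
    exact absurd (h2.trans (mk_neighbor_le _ _ _ _ h3)) (not_le.2 hlt)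
end
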